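/- For every positive integer t there exists a constant d0(t) with the following property: for every tree T on t+1 vertices and every finite simple graph G on n vertices with average degree d = 2|E(G)|/n at least d0(t), the number of injective graph homomorphisms from T to G is at least n·d(d−1)(d−2)···(d−t+1). -/

import Mathlib

/-- Number of injective graph homomorphisms ("labeled copies") from `T` to `G`. -/
noncomputable def monCount {α β : Type} (T : SimpleGraph α) (G : SimpleGraph β) : ℕ :=
  Nat.card {f : α → β // Function.Injective f ∧ ∀ ⦃u v : α⦄, T.Adj u v → G.Adj (f u) (f v)}

/-- Average degree `d = 2|E(G)|/n` of a finite graph. -/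
noncomputable def avgDeg {β : Type} [Fintype β] (G : SimpleGraph β) : ℝ :=
  2 * (Nat.card G.edgeSet) / (Fintype.card β)

/-- Falling factorial `(x)_t = x(x-1)⋯(x-t+1)` of a real number. -/
noncomputable def fallFact (x : ℝ) (t : ℕ) : ℝ := ∏ i ∈ Finset.range t, (x - (i : ℝ))

set_option linter.unusedSectionVars false

namespace TreeCount

open Finset

section
variable {V : Type} [Fintype V] [DecidableEq V] (G : SimpleGraph V) [DecidableRel G.Adj]
variable (par : ℕ → ℕ)

/-- Allowed extensions at step `j`. -/
def ext (j : ℕ) (φ : ℕ → V) : Finset V :=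
  G.neighborFinset (φ (par j)) \ (range j).image φ

/-- Number of allowed extensions. -/
def X (j : ℕ) (φ : ℕ → V) : ℝ := ((ext G par j φ).card : ℝ)

/-- degree as a real -/
def D (v : V) : ℝ := (G.degree v : ℝ)

/-- stationary expectation -/
noncomputable def Epi (f : V → ℝ) : ℝ := (∑ v, D G v * f v) / ∑ v, D G v

/-- Markov operator -/
noncomputable def P (f : V → ℝ) (v : V) : ℝ := (∑ w ∈ G.neighborFinset v, f w) / D G v

/-- old vertices adjacent to the parent -/
def U (j : ℕ) (φ : ℕ → V) : Finset ℕ :=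
  ((range j).erase (par j)).filter (fun a => G.Adj (φ (par j)) (φ a))

/-- old vertices not adjacent to the parent -/
def C (j : ℕ) (φ : ℕ → V) : Finset ℕ :=
  ((range j).erase (par j)).filter (fun a => ¬ G.Adj (φ (par j)) (φ a))

lemma inter_eq (j : ℕ) (φ : ℕ → V) :
    G.neighborFinset (φ (par j)) ∩ (range j).image φ = (U G par j φ).image φ := by
  ext w
  simp only [U, mem_inter, SimpleGraph.mem_neighborFinset, mem_image, mem_range, mem_filter,
    mem_erase]
  constructor
  · rintro ⟨h, a, ha, rfl⟩
    refine ⟨a, ⟨⟨?_, ha⟩, h⟩, rfl⟩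
    rintro rfl
    exact G.loopless.irrefl _ h
  · rintro ⟨a, ⟨⟨_, ha⟩, h⟩, rfl⟩
    exact ⟨h, a, ha, rfl⟩

lemma U_inj {j : ℕ} {φ : ℕ → V} (h : Set.InjOn φ (range j : Finset ℕ)) :
    Set.InjOn φ (U G par j φ : Finset ℕ) := by
  apply h.mono
  intro a ha
  simp [U] at ha ⊢
  exact ha.1.2

lemma X_eq {j : ℕ} {φ : ℕ → V} (h : Set.InjOn φ (range j : Finset ℕ)) :
    X G par j φ = D G (φ (par j)) - (U G par j φ).card := by
  have h1 := Finset.card_sdiff_add_card_inter (G.neighborFinset (φ (par j))) ((range j).image φ)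
  rw [inter_eq, card_image_of_injOn (U_inj G par h)] at h1
  unfold X ext D
  rw [← G.card_neighborFinset_eq_degree, ← h1]
  push_cast
  ring

lemma sum_ext {j : ℕ} {φ : ℕ → V} (h : Set.InjOn φ (range j : Finset ℕ)) (f : V → ℝ) :
    ∑ w ∈ ext G par j φ, f w
      = ∑ w ∈ G.neighborFinset (φ (par j)), f w - ∑ a ∈ U G par j φ, f (φ a) := by
  have h1 := Finset.sum_inter_add_sum_sdiff (G.neighborFinset (φ (par j))) ((range j).image φ) f
  rw [inter_eq, sum_image (U_inj G par h)] at h1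
  unfold ext
  linarith

lemma card_UC {j : ℕ} (φ : ℕ → V) (hp : par j < j) :
    ((U G par j φ).card : ℝ) + (C G par j φ).card = j - 1 := by
  have := Finset.card_filter_add_card_filter_not (s := (range j).erase (par j))
    (fun a => G.Adj (φ (par j)) (φ a))
  rw [card_erase_of_mem (mem_range.2 hp), card_range] at this
  have h2 : ((U G par j φ).card : ℝ) + (C G par j φ).card = ((j - 1 : ℕ) : ℝ) := by
    rw [← this]; push_cast; rfl
  rw [h2, Nat.cast_sub (by omega)]; simp

lemma sum_UC {j : ℕ} (φ : ℕ → V) (g : ℕ → ℝ) :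
    ∑ a ∈ U G par j φ, g a + ∑ a ∈ C G par j φ, g a = ∑ a ∈ (range j).erase (par j), g a :=
  Finset.sum_filter_add_sum_filter_not _ _ _

variable {G} in
lemma Epi_mono {f g : V → ℝ} (h : ∀ v, f v ≤ g v) : Epi G f ≤ Epi G g := by
  unfold Epi
  apply div_le_div_of_nonneg_right _ (sum_nonneg fun v _ => by unfold D; positivity)
  exact sum_le_sum fun v _ => mul_le_mul_of_nonneg_left (h v) (by unfold D; positivity)

lemma Epi_nonneg {f : V → ℝ} (h : ∀ v, 0 ≤ f v) : 0 ≤ Epi G f := by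
  have := Epi_mono (G := G) h
  simpa [Epi] using this

lemma Epi_P (hD : ∀ v, 0 < D G v) (f : V → ℝ) : Epi G (P G f) = Epi G f := by
  unfold Epi
  congr 1
  have : ∀ v, D G v * P G f v = ∑ w, if G.Adj v w then f w else 0 := by
    intro v
    unfold P
    rw [mul_div_cancel₀ _ (hD v).ne', ← sum_filter]
    apply sum_congr _ (fun _ _ => rfl)
    ext; simp
  simp_rw [this]
  rw [sum_comm]
  apply sum_congr rfl
  intro w _
  rw [← sum_filter, sum_const, nsmul_eq_mul]
  congr 1
  unfold D
  rw [← G.card_neighborFinset_eq_degree]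
  congr 2
  ext; simp [G.adj_comm]

lemma abs_P (f : V → ℝ) (v : V) : |P G f v| ≤ P G (fun w => |f w|) v := by
  unfold P
  rw [abs_div, abs_of_nonneg (a := D G v) (by unfold D; positivity)]
  apply div_le_div_of_nonneg_right (abs_sum_le_sum_abs _ _)  (by unfold D; positivity)

lemma sq_P (f : V → ℝ) (v : V) : (P G f v)^2 ≤ P G (fun w => (f w)^2) v := by
  unfold P
  rcases eq_or_lt_of_le (show 0 ≤ D G v by unfold D; positivity) with h | h
  · simp [← h]
  · rw [div_pow, div_le_div_iff₀ (by positivity) h]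
    have := sq_sum_le_card_mul_sum_sq (s := G.neighborFinset v) (f := f)
    rw [G.card_neighborFinset_eq_degree] at this
    change _ ≤ D G v * _ at this
    nlinarith

end
end TreeCount

namespace TreeCount

open Finset

section
variable {V : Type} [Fintype V] [DecidableEq V] {G : SimpleGraph V} [DecidableRel G.Adj]
variable {par : ℕ → ℕ}

/-- The abstract properties of the random embedding process. -/
structure Ctx (G : SimpleGraph V) [DecidableRel G.Adj] (par : ℕ → ℕ) (t : ℕ) (d : ℝ)
    (E : ((ℕ → V) → ℝ) →ₗ[ℝ] ℝ) : Prop where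
  t_pos : 1 ≤ t
  par_lt : ∀ j, 1 ≤ j → j ≤ t → par j < j
  mono : ∀ F H : (ℕ → V) → ℝ,
    (∀ φ, Set.InjOn φ (range (t + 1) : Finset ℕ) → F φ ≤ H φ) → E F ≤ E H
  one : E (fun _ => 1) = 1
  zero : ∀ f : V → ℝ, E (fun φ => f (φ 0)) = Epi G f
  step : ∀ j, 1 ≤ j → j ≤ t → ∀ f : V → ℝ,
    E (fun φ => f (φ j)) = E (fun φ => (∑ w ∈ ext G par j φ, f w) / X G par j φ)
  deg : ∀ v, d / 8 ≤ D G v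
  dbig : 16 * (t : ℝ) ≤ d

variable {t : ℕ} {d : ℝ} {E : ((ℕ → V) → ℝ) →ₗ[ℝ] ℝ}

lemma E_add (F H : (ℕ → V) → ℝ) : E (fun φ => F φ + H φ) = E F + E H := map_add E F H
lemma E_sub (F H : (ℕ → V) → ℝ) : E (fun φ => F φ - H φ) = E F - E H := map_sub E F H
lemma E_smul (c : ℝ) (F : (ℕ → V) → ℝ) : E (fun φ => c * F φ) = c * E F := map_smul E c F
lemma E_sum {ι : Type} (s : Finset ι) (F : ι → (ℕ → V) → ℝ) :
    E (fun φ => ∑ a ∈ s, F a φ) = ∑ a ∈ s, E (F a) := by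
  rw [← map_sum]; congr 1; ext φ; simp

namespace Ctx

lemma t1 (c : Ctx G par t d E)
    : (1 : ℝ) ≤ t := by exact_mod_cast c.t_pos
lemma dpos (c : Ctx G par t d E)
    : 0 < d := by linarith [c.dbig, c.t1]
lemma Dpos (c : Ctx G par t d E)
    (v : V) : 0 < D G v := by linarith [c.deg v, c.dpos]

lemma E_congr (c : Ctx G par t d E) {F H : (ℕ → V) → ℝ}
    (h : ∀ φ, Set.InjOn φ (range (t + 1) : Finset ℕ) → F φ = H φ) : E F = E H :=
  le_antisymm (c.mono _ _ fun φ hφ => (h φ hφ).le) (c.mono _ _ fun φ hφ => (h φ hφ).ge)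

lemma E_abs (c : Ctx G par t d E)
    (F : (ℕ → V) → ℝ) : |E F| ≤ E (fun φ => |F φ|) := by
  rw [abs_le]
  constructor
  · have : E (fun φ => (-1) * |F φ|) ≤ E F := c.mono _ _ fun φ _ => by
      have := neg_abs_le (F φ); linarith
    rw [E_smul] at this; linarith
  · exact c.mono _ _ fun φ _ => le_abs_self _

lemma E_nonneg (c : Ctx G par t d E) {F : (ℕ → V) → ℝ}
    (h : ∀ φ, Set.InjOn φ (range (t + 1) : Finset ℕ) → 0 ≤ F φ) : 0 ≤ E F := by
  have := c.mono 0 F h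
  simpa using this

lemma inj' (c : Ctx G par t d E)
    {φ : ℕ → V} (h : Set.InjOn φ (range (t + 1) : Finset ℕ)) {j : ℕ} (hj : j ≤ t) :
    Set.InjOn φ (range j : Finset ℕ) := by
  apply h.mono
  intro a; simp; omega

section pointwise

lemma U_le (c : Ctx G par t d E)
    {φ : ℕ → V} (h : Set.InjOn φ (range (t + 1) : Finset ℕ)) {j : ℕ} (hj1 : 1 ≤ j) (hj : j ≤ t)
    : ((U G par j φ).card : ℝ) ≤ t := by
  have := card_UC G par φ (c.par_lt j hj1 hj)
  have h2 : (0 : ℝ) ≤ (C G par j φ).card := by positivity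
  have h3 : (j : ℝ) ≤ t := by exact_mod_cast hj
  linarith

lemma C_le (c : Ctx G par t d E)
    {φ : ℕ → V} (h : Set.InjOn φ (range (t + 1) : Finset ℕ)) {j : ℕ} (hj1 : 1 ≤ j) (hj : j ≤ t)
    : ((C G par j φ).card : ℝ) ≤ t := by
  have := card_UC G par φ (c.par_lt j hj1 hj)
  have h2 : (0 : ℝ) ≤ (U G par j φ).card := by positivity
  have h3 : (j : ℝ) ≤ t := by exact_mod_cast hj
  linarith

lemma X_half (c : Ctx G par t d E)
    {φ : ℕ → V} (h : Set.InjOn φ (range (t + 1) : Finset ℕ)) {j : ℕ} (hj1 : 1 ≤ j) (hj : j ≤ t)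
    : D G (φ (par j)) / 2 ≤ X G par j φ := by
  rw [X_eq G par (c.inj' h hj)]
  have := c.U_le h hj1 hj
  linarith [c.deg (φ (par j)), c.dbig]

lemma X_ge (c : Ctx G par t d E)
    {φ : ℕ → V} (h : Set.InjOn φ (range (t + 1) : Finset ℕ)) {j : ℕ} (hj1 : 1 ≤ j) (hj : j ≤ t)
    : d / 16 ≤ X G par j φ := by
  have := c.X_half h hj1 hj
  linarith [c.deg (φ (par j))]

lemma X_pos (c : Ctx G par t d E)
    {φ : ℕ → V} (h : Set.InjOn φ (range (t + 1) : Finset ℕ)) {j : ℕ} (hj1 : 1 ≤ j) (hj : j ≤ t)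
    : 0 < X G par j φ := by
  have := c.X_ge h hj1 hj
  linarith [c.dpos]

lemma inv_X_le (c : Ctx G par t d E)
    {φ : ℕ → V} (h : Set.InjOn φ (range (t + 1) : Finset ℕ)) {j : ℕ} (hj1 : 1 ≤ j) (hj : j ≤ t)
    : 1 / X G par j φ ≤ 16 / d := by
  rw [div_le_div_iff₀ (c.X_pos h hj1 hj) c.dpos]
  linarith [c.X_ge h hj1 hj]

lemma step_id (c : Ctx G par t d E)
    {φ : ℕ → V} (h : Set.InjOn φ (range (t + 1) : Finset ℕ)) {j : ℕ} (hj1 : 1 ≤ j) (hj : j ≤ t)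
    (f : V → ℝ) : (∑ w ∈ ext G par j φ, f w) / X G par j φ
    = P G f (φ (par j)) + (∑ a ∈ U G par j φ, (P G f (φ (par j)) - f (φ a))) / X G par j φ := by
  have hX := c.X_pos h hj1 hj
  rw [sum_ext G par (c.inj' h hj)]
  have h1 : ∑ w ∈ G.neighborFinset (φ (par j)), f w = D G (φ (par j)) * P G f (φ (par j)) := by
    unfold P; rw [mul_div_cancel₀ _ (c.Dpos _).ne']
  have h2 := X_eq G par (c.inj' h hj)
  rw [sum_sub_distrib, sum_const, nsmul_eq_mul, h1]
  rw [div_eq_iff hX.ne', add_mul, div_mul_cancel₀ _ hX.ne', h2]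
  ring

end pointwise

lemma step' (c : Ctx G par t d E)
    {j : ℕ} (hj1 : 1 ≤ j) (hj : j ≤ t) (f : V → ℝ) :
    E (fun φ => f (φ j)) = E (fun φ => P G f (φ (par j))) +
      E (fun φ => (∑ a ∈ U G par j φ, (P G f (φ (par j)) - f (φ a))) / X G par j φ) := by
  rw [c.step j hj1 hj, ← E_add]
  exact c.E_congr fun φ h => c.step_id h hj1 hj f

lemma dom_aux (c : Ctx G par t d E)
    : ∀ j ≤ t, ∀ g : V → ℝ, (∀ v, 0 ≤ g v) →
    E (fun φ => g (φ j)) ≤ 2 ^ j * Epi G g := by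
  intro j
  induction j using Nat.strong_induction_on with
  | _ j ih =>
  intro hj g hg
  rcases Nat.eq_zero_or_pos j with rfl | hj1
  · simp [c.zero]
  have hp := c.par_lt j hj1 hj
  have hPg : ∀ v, 0 ≤ P G g v := fun v =>
    div_nonneg (sum_nonneg fun w _ => hg w) (c.Dpos v).le
  have h1 : E (fun φ => g (φ j)) ≤ E (fun φ => 2 * P G g (φ (par j))) := by
    rw [c.step j hj1 hj]
    apply c.mono
    intro φ h
    have hX := c.X_pos h hj1 hj
    rw [div_le_iff₀ hX]
    have h3 : ∑ w ∈ ext G par j φ, g w ≤ ∑ w ∈ G.neighborFinset (φ (par j)), g w :=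
      sum_le_sum_of_subset_of_nonneg sdiff_subset fun w _ _ => hg w
    have h4 : ∑ w ∈ G.neighborFinset (φ (par j)), g w = D G (φ (par j)) * P G g (φ (par j)) := by
      unfold P; rw [mul_div_cancel₀ _ (c.Dpos _).ne']
    have := c.X_half h hj1 hj
    nlinarith [hPg (φ (par j))]
  rw [E_smul] at h1
  have h2 := ih _ hp (by omega) (P G g) hPg
  rw [Epi_P G c.Dpos] at h2
  have h5 : (2 : ℝ) ^ (par j + 1) ≤ 2 ^ j := pow_le_pow_right₀ (by norm_num) hp
  have h6 := Epi_nonneg G hg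
  rw [pow_succ] at h5
  nlinarith

lemma dom (c : Ctx G par t d E)
    {j : ℕ} (hj : j ≤ t) {g : V → ℝ} (hg : ∀ v, 0 ≤ g v) :
    E (fun φ => g (φ j)) ≤ 2 ^ t * Epi G g := by
  refine (c.dom_aux j hj g hg).trans ?_
  apply mul_le_mul_of_nonneg_right _ (Epi_nonneg G hg)
  exact pow_le_pow_right₀ (by norm_num) hj

lemma Epi_abs_P (c : Ctx G par t d E)
    (f : V → ℝ) : Epi G (fun v => |P G f v|) ≤ Epi G (fun v => |f v|) := by
  rw [← Epi_P G c.Dpos (fun v => |f v|)]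
  exact Epi_mono (abs_P G f)

lemma Epi_sq_P (c : Ctx G par t d E)
    (f : V → ℝ) : Epi G (fun v => (P G f v)^2) ≤ Epi G (fun v => (f v)^2) := by
  rw [← Epi_P G c.Dpos (fun v => (f v)^2)]
  exact Epi_mono (sq_P G f)

lemma crude (c : Ctx G par t d E)
    (M : ℝ) : ∀ j ≤ t, ∀ f : V → ℝ, Epi G f = 0 → Epi G (fun v => |f v|) ≤ M →
    |E (fun φ => f (φ j))| ≤ j * (32 * t * 2 ^ t * M / d) := by
  intro j
  induction j using Nat.strong_induction_on with
  | _ j ih =>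
  intro hj f hf0 hfM
  have hM : 0 ≤ M := (Epi_nonneg G fun v => abs_nonneg (f v)).trans hfM
  rcases Nat.eq_zero_or_pos j with rfl | hj1
  · simp [c.zero, hf0]
  have hp := c.par_lt j hj1 hj
  have hd := c.dpos
  have hPM : Epi G (fun v => |P G f v|) ≤ M := (c.Epi_abs_P f).trans hfM
  rw [c.step' hj1 hj]
  have h1 := ih _ hp (by omega) (P G f) (by rw [Epi_P G c.Dpos, hf0]) hPM
  have h2 : |E (fun φ => (∑ a ∈ U G par j φ, (P G f (φ (par j)) - f (φ a))) / X G par j φ)|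
      ≤ 32 * t * 2 ^ t * M / d := by
    refine (c.E_abs _).trans ?_
    have h3 : E (fun φ => |(∑ a ∈ U G par j φ, (P G f (φ (par j)) - f (φ a))) / X G par j φ|)
        ≤ E (fun φ => 16 / d * ∑ a ∈ (range j).erase (par j),
          (|P G f (φ (par j))| + |f (φ a)|)) := by
      apply c.mono
      intro φ h
      rw [abs_div, abs_of_pos (c.X_pos h hj1 hj), div_eq_mul_one_div, mul_comm]
      apply mul_le_mul (c.inv_X_le h hj1 hj) _ (abs_nonneg _) (by positivity)
      refine (abs_sum_le_sum_abs _ _).trans ?_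
      refine (sum_le_sum fun a _ => abs_sub _ _).trans ?_
      exact sum_le_sum_of_subset_of_nonneg (filter_subset _ _) fun a _ _ => by positivity
    refine h3.trans ?_
    rw [E_smul, E_sum]
    have h4 : ∀ a ∈ (range j).erase (par j),
        E (fun φ => |P G f (φ (par j))| + |f (φ a)|) ≤ 2 * 2 ^ t * M := by
      intro a ha
      rw [mem_erase, mem_range] at ha
      rw [E_add]
      have h5 := c.dom (j := par j) (by omega) (g := fun v => |P G f v|) (fun v => abs_nonneg _)
      have h6 := c.dom (j := a) (by omega) (g := fun v => |f v|) (fun v => abs_nonneg _)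
      have h7 : (0 : ℝ) ≤ 2 ^ t := by positivity
      nlinarith [mul_le_mul_of_nonneg_left hPM h7, mul_le_mul_of_nonneg_left hfM h7]
    have h8 := sum_le_card_nsmul _ _ _ h4
    rw [card_erase_of_mem (mem_range.2 hp), card_range, nsmul_eq_mul] at h8
    have h9 : ((j - 1 : ℕ) : ℝ) ≤ t := by exact_mod_cast (by omega)
    calc _ ≤ 16 / d * (t * (2 * 2 ^ t * M)) := by
          apply mul_le_mul_of_nonneg_left _ (by positivity)
          refine h8.trans ?_
          apply mul_le_mul_of_nonneg_right h9 (by positivity)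
      _ = _ := by ring
  have h10 : (par j : ℝ) + 1 ≤ j := by exact_mod_cast hp
  have h11 : 0 ≤ 32 * t * 2 ^ t * M / d := by positivity
  refine (abs_add_le _ _).trans ?_
  nlinarith [mul_le_mul_of_nonneg_right h10 h11]

end Ctx
end
end TreeCount

namespace TreeCount

open Finset

section
variable {V : Type} [Fintype V] [DecidableEq V] {G : SimpleGraph V} [DecidableRel G.Adj]
variable {par : ℕ → ℕ} {t : ℕ} {d : ℝ} {E : ((ℕ → V) → ℝ) →ₗ[ℝ] ℝ}

/-- normalised degree deviation -/
noncomputable def yy (G : SimpleGraph V) [DecidableRel G.Adj] (d : ℝ) (v : V) : ℝ := 1 - d / D G v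

/-- expected slack -/
noncomputable def Sl (G : SimpleGraph V) [DecidableRel G.Adj] (par : ℕ → ℕ)
    (E : ((ℕ → V) → ℝ) →ₗ[ℝ] ℝ) (j : ℕ) : ℝ :=
  E (fun φ => (C G par j φ).card / X G par j φ)

namespace Ctx

lemma inv_diff (c : Ctx G par t d E)
    {φ : ℕ → V} (h : Set.InjOn φ (range (t + 1) : Finset ℕ)) {j : ℕ} (hj1 : 1 ≤ j)
    (hj : j ≤ t) : |1 / X G par j φ - 1 / d| ≤ 2 * |yy G d (φ (par j))| / d + 16 * t / d ^ 2 := by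
  have hX := c.X_pos h hj1 hj
  have hX2 := c.X_half h hj1 hj
  have hX3 := c.X_ge h hj1 hj
  have hd := c.dpos
  have hD := c.Dpos (φ (par j))
  have hU := c.U_le h hj1 hj
  have hXe := X_eq G par (c.inj' h hj)
  set q := φ (par j)
  set x := X G par j φ
  set u : ℝ := ((U G par j φ).card : ℝ)
  have hu : 0 ≤ u := by positivity
  have hy : D G q * yy G d q = D G q - d := by
    unfold yy; field_simp
  have e : 1 / x - 1 / d = (u - D G q * yy G d q) / (x * d) := by
    rw [hy]; field_simp; linarith
  rw [e, abs_div, abs_of_pos (by positivity : 0 < x * d), div_le_iff₀ (by positivity)]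
  have h1 : |u - D G q * yy G d q| ≤ u + D G q * |yy G d q| := by
    refine (abs_sub _ _).trans ?_
    rw [abs_mul, abs_of_pos hD, abs_of_nonneg hu]
  refine h1.trans ?_
  have h2 : (2 * |yy G d q| / d + 16 * t / d ^ 2) * (x * d) = 2 * |yy G d q| * x + 16 * t * x / d := by
    field_simp
  rw [h2]
  have h3 : (t : ℝ) ≤ 16 * t * x / d := by
    rw [le_div_iff₀ hd]
    have : (0:ℝ) ≤ t := by positivity
    nlinarith
  nlinarith [abs_nonneg (yy G d q)]

lemma rest_bound (c : Ctx G par t d E)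
    (f : V → ℝ) {φ : ℕ → V} (h : Set.InjOn φ (range (t + 1) : Finset ℕ)) {j : ℕ}
    (hj1 : 1 ≤ j) (hj : j ≤ t) {η : ℝ} (hη : 0 < η) :
    |(∑ a ∈ U G par j φ, (P G f (φ (par j)) - f (φ a))) / X G par j φ
      - 1 / d * ∑ a ∈ (range j).erase (par j), (P G f (φ (par j)) - f (φ a))|
    ≤ η * ((C G par j φ).card / X G par j φ) + ∑ a ∈ (range j).erase (par j),
      (1 / d * (yy G d (φ (par j))) ^ 2 + (1 / d + 4 / (η * d)) *
          (2 * (P G f (φ (par j)))^2 + 2 * (f (φ a))^2)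
        + 16 * t / d ^ 2 * (|P G f (φ (par j))| + |f (φ a)|)) := by
  have hX := c.X_pos h hj1 hj
  have hd := c.dpos
  have hi := c.inv_X_le h hj1 hj
  have hdiff := c.inv_diff h hj1 hj
  have hs := sum_UC G par (j := j) φ (fun a => P G f (φ (par j)) - f (φ a))
  set q := φ (par j)
  set x := X G par j φ
  set y := yy G d q
  set S := (range j).erase (par j)
  have e : (∑ a ∈ U G par j φ, (P G f q - f (φ a))) / x - 1 / d * ∑ a ∈ S, (P G f q - f (φ a))
     = (1 / x - 1 / d) * ∑ a ∈ S, (P G f q - f (φ a))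
       - 1 / x * ∑ a ∈ C G par j φ, (P G f q - f (φ a)) := by
    rw [← hs]; ring
  rw [e]
  have b1 : |(1 / x - 1 / d) * ∑ a ∈ S, (P G f q - f (φ a))| ≤ ∑ a ∈ S,
      (1 / d * y ^ 2 + 1 / d * (2 * (P G f q)^2 + 2 * (f (φ a))^2)
        + 16 * t / d ^ 2 * (|P G f q| + |f (φ a)|)) := by
    rw [mul_sum]
    refine (abs_sum_le_sum_abs _ _).trans (sum_le_sum fun a _ => ?_)
    rw [abs_mul]
    have k1 : |P G f q - f (φ a)| ≤ |P G f q| + |f (φ a)| := abs_sub _ _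
    have k2 : |P G f q - f (φ a)|^2 ≤ 2 * (P G f q)^2 + 2 * (f (φ a))^2 := by
      rw [sq_abs]; nlinarith [sq_nonneg (P G f q + f (φ a))]
    have k3 := abs_nonneg (P G f q - f (φ a))
    set δ := |P G f q - f (φ a)|
    calc |1 / x - 1 / d| * δ ≤ (2 * |y| / d + 16 * t / d ^ 2) * δ :=
          mul_le_mul_of_nonneg_right hdiff k3
      _ = 1 / d * (2 * |y| * δ) + 16 * t / d ^ 2 * δ := by ring
      _ ≤ 1 / d * (y ^ 2 + δ ^ 2) + 16 * t / d ^ 2 * δ := by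
          have : 2 * |y| * δ ≤ y ^ 2 + δ ^ 2 := by
            rw [← sq_abs y]; nlinarith [sq_nonneg (|y| - δ)]
          gcongr
      _ ≤ 1 / d * (y ^ 2 + (2 * (P G f q)^2 + 2 * (f (φ a))^2))
            + 16 * t / d ^ 2 * (|P G f q| + |f (φ a)|) := by gcongr
      _ = _ := by ring
  have b2 : |1 / x * ∑ a ∈ C G par j φ, (P G f q - f (φ a))| ≤ η * ((C G par j φ).card / x)
      + ∑ a ∈ S, (4 / (η * d)) * (2 * (P G f q)^2 + 2 * (f (φ a))^2) := by
    rw [mul_sum]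
    have k0 : ∀ a ∈ C G par j φ, |1 / x * (P G f q - f (φ a))| ≤
        η * (1 / x) + (4 / (η * d)) * (2 * (P G f q)^2 + 2 * (f (φ a))^2) := by
      intro a _
      rw [abs_mul, abs_of_pos (by positivity : 0 < 1 / x)]
      have k2 : |P G f q - f (φ a)|^2 ≤ 2 * (P G f q)^2 + 2 * (f (φ a))^2 := by
        rw [sq_abs]; nlinarith [sq_nonneg (P G f q + f (φ a))]
      set δ := |P G f q - f (φ a)|
      have k4 : δ ≤ η + δ ^ 2 / (4 * η) := by
        have : 0 ≤ (δ - 2 * η) ^ 2 / (4 * η) := by positivity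
        have e2 : (δ - 2 * η) ^ 2 / (4 * η) = δ ^ 2 / (4 * η) - δ + η := by field_simp; ring
        linarith
      calc 1 / x * δ ≤ 1 / x * (η + δ ^ 2 / (4 * η)) := by gcongr
        _ = η * (1 / x) + 1 / x * (δ ^ 2 / (4 * η)) := by ring
        _ ≤ η * (1 / x) + 16 / d * ((2 * (P G f q)^2 + 2 * (f (φ a))^2) / (4 * η)) := by gcongr
        _ = _ := by field_simp; ring
    refine (abs_sum_le_sum_abs _ _).trans ((sum_le_sum k0).trans ?_)
    rw [sum_add_distrib, sum_const, nsmul_eq_mul]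
    have : ∑ a ∈ C G par j φ, (4 / (η * d)) * (2 * (P G f q)^2 + 2 * (f (φ a))^2)
       ≤ ∑ a ∈ S, (4 / (η * d)) * (2 * (P G f q)^2 + 2 * (f (φ a))^2) :=
      sum_le_sum_of_subset_of_nonneg (filter_subset _ _) fun a _ _ => by positivity
    have e3 : ((C G par j φ).card : ℝ) * (η * (1 / x)) = η * ((C G par j φ).card / x) := by ring
    linarith
  refine (abs_sub _ _).trans ((add_le_add b1 b2).trans (le_of_eq ?_))
  rw [add_left_comm, ← sum_add_distrib]
  congr 1
  apply sum_congr rfl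
  intro a _
  ring

lemma fine_R (c : Ctx G par t d E)
    {M Q : ℝ} (hMQ : M ≤ 8 * d * Q)
    (hy : Epi G (fun v => (yy G d v)^2) ≤ Q) {j : ℕ} (hj1 : 1 ≤ j) (hj : j ≤ t) {f : V → ℝ}
    (hf0 : Epi G f = 0) (hfM : Epi G (fun v => |f v|) ≤ M)
    (hfQ : Epi G (fun v => (f v)^2) ≤ Q) :
    |E (fun φ => (∑ a ∈ U G par j φ, (P G f (φ (par j)) - f (φ a))) / X G par j φ)|
      ≤ 1 / (16 * t) * E (fun φ => (C G par j φ).card / X G par j φ)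
        + 1100 * t ^ 3 * 2 ^ t * Q / d := by
  have hp := c.par_lt j hj1 hj
  have hd := c.dpos
  have ht := c.t1
  have hM : 0 ≤ M := (Epi_nonneg G fun v => abs_nonneg (f v)).trans hfM
  have hQ : 0 ≤ Q := (Epi_nonneg G fun v => sq_nonneg (f v)).trans hfQ
  have hPM : Epi G (fun v => |P G f v|) ≤ M := (c.Epi_abs_P f).trans hfM
  have hPQ : Epi G (fun v => (P G f v)^2) ≤ Q := (c.Epi_sq_P f).trans hfQ
  set S := (range j).erase (par j) with hS
  set η : ℝ := 1 / (16 * t) with hηd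
  have hη : 0 < η := by positivity
  have hA : (0 : ℝ) ≤ 2 ^ t := by positivity
  have hcard : (S.card : ℝ) ≤ t := by
    rw [hS, card_erase_of_mem (mem_range.2 hp), card_range]
    exact_mod_cast (by omega)
  have haj : ∀ a ∈ S, a ≤ t := by
    intro a ha
    rw [hS, mem_erase, mem_range] at ha; omega
  -- main term
  have m1 : |E (fun φ => 1 / d * ∑ a ∈ S, (P G f (φ (par j)) - f (φ a)))|
      ≤ 1 / d * (t * (2 * (t * (32 * t * 2 ^ t * M / d)))) := by
    rw [E_smul, E_sum, abs_mul, abs_of_pos (by positivity : 0 < 1 / d)]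
    apply mul_le_mul_of_nonneg_left _ (by positivity)
    refine (abs_sum_le_sum_abs _ _).trans ?_
    have k : ∀ a ∈ S, |E (fun φ => P G f (φ (par j)) - f (φ a))|
        ≤ 2 * (t * (32 * t * 2 ^ t * M / d)) := by
      intro a ha
      rw [E_sub]
      have k1 := c.crude M (par j) (by omega) (P G f) (by rw [Epi_P G c.Dpos, hf0]) hPM
      have k2 := c.crude M a (haj a ha) f hf0 hfM
      have k3 : (par j : ℝ) ≤ t := by exact_mod_cast (by omega)
      have k4 : (a : ℝ) ≤ t := by exact_mod_cast haj a ha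
      have k5 : 0 ≤ 32 * t * 2 ^ t * M / d := by positivity
      refine (abs_sub _ _).trans ?_
      nlinarith [mul_le_mul_of_nonneg_right k3 k5, mul_le_mul_of_nonneg_right k4 k5]
    have k8 := sum_le_card_nsmul _ _ _ k
    rw [nsmul_eq_mul] at k8
    refine k8.trans ?_
    apply mul_le_mul_of_nonneg_right hcard (by positivity)
  -- error term
  have m2 : |E (fun φ => (∑ a ∈ U G par j φ, (P G f (φ (par j)) - f (φ a))) / X G par j φ
      - 1 / d * ∑ a ∈ S, (P G f (φ (par j)) - f (φ a)))|
      ≤ η * E (fun φ => (C G par j φ).card / X G par j φ) +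
        t * (1 / d * (2 ^ t * Q) + (1 / d + 4 / (η * d)) * (4 * 2 ^ t * Q)
          + 16 * t / d ^ 2 * (2 * 2 ^ t * M)) := by
    refine (c.E_abs _).trans ((c.mono _ _ fun φ h => c.rest_bound f h hj1 hj hη).trans ?_)
    rw [E_add, E_smul, E_sum]
    have k : ∀ a ∈ S, E (fun φ => 1 / d * (yy G d (φ (par j))) ^ 2 + (1 / d + 4 / (η * d)) *
          (2 * (P G f (φ (par j)))^2 + 2 * (f (φ a))^2)
        + 16 * t / d ^ 2 * (|P G f (φ (par j))| + |f (φ a)|))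
        ≤ 1 / d * (2 ^ t * Q) + (1 / d + 4 / (η * d)) * (4 * 2 ^ t * Q)
          + 16 * t / d ^ 2 * (2 * 2 ^ t * M) := by
      intro a ha
      simp only [E_add, E_smul]
      have l1 := c.dom (j := par j) (by omega) (g := fun v => (yy G d v)^2) (fun v => sq_nonneg _)
      have l2 := c.dom (j := par j) (by omega) (g := fun v => (P G f v)^2) (fun v => sq_nonneg _)
      have l3 := c.dom (haj a ha) (g := fun v => (f v)^2) (fun v => sq_nonneg _)
      have l4 := c.dom (j := par j) (by omega) (g := fun v => |P G f v|) (fun v => abs_nonneg _)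
      have l5 := c.dom (haj a ha) (g := fun v => |f v|) (fun v => abs_nonneg _)
      have l1' := l1.trans (mul_le_mul_of_nonneg_left hy hA)
      have l2' := l2.trans (mul_le_mul_of_nonneg_left hPQ hA)
      have l3' := l3.trans (mul_le_mul_of_nonneg_left hfQ hA)
      have l4' := l4.trans (mul_le_mul_of_nonneg_left hPM hA)
      have l5' := l5.trans (mul_le_mul_of_nonneg_left hfM hA)
      gcongr
      · linarith
      · linarith
    have k8 := sum_le_card_nsmul _ _ _ k
    rw [nsmul_eq_mul] at k8
    have : 0 ≤ 1 / d * (2 ^ t * Q) + (1 / d + 4 / (η * d)) * (4 * 2 ^ t * Q)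
          + 16 * t / d ^ 2 * (2 * 2 ^ t * M) := by positivity
    have := mul_le_mul_of_nonneg_right hcard this
    linarith
  rw [E_sub] at m2
  have tri : ∀ a b : ℝ, |a| ≤ |a - b| + |b| := fun a b => by
    have := abs_add_le (a - b) b; simpa using this
  refine (tri _ _).trans ((add_le_add m2 m1).trans ?_)
  rw [add_assoc]
  gcongr
  have hM' : M / d ≤ 8 * Q := by rw [div_le_iff₀ hd]; linarith
  have hη2 : 4 / (η * d) = 64 * t / d := by rw [hηd]; field_simp; ring
  rw [hη2]
  calc _ = (2 ^ t / d) * (t * Q + (1 + 64 * t) * 4 * t * Q + 32 * t ^ 2 * (M / d)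
          + 64 * t ^ 3 * (M / d)) := by field_simp; ring
    _ ≤ (2 ^ t / d) * (t * Q + (1 + 64 * t) * 4 * t * Q + 32 * t ^ 2 * (8 * Q)
          + 64 * t ^ 3 * (8 * Q)) := by gcongr
    _ ≤ (2 ^ t / d) * (1100 * t ^ 3 * Q) := by
        apply mul_le_mul_of_nonneg_left _ (by positivity)
        have a1 : (t : ℝ) ^ 2 ≤ t ^ 3 := pow_le_pow_right₀ ht (by norm_num)
        have a2 : (t : ℝ) ≤ t ^ 3 := by simpa using pow_le_pow_right₀ ht (show 1 ≤ 3 by norm_num)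
        nlinarith [mul_le_mul_of_nonneg_right a1 hQ, mul_le_mul_of_nonneg_right a2 hQ]
    _ = _ := by ring

lemma fine (c : Ctx G par t d E)
    {M Q : ℝ} (hMQ : M ≤ 8 * d * Q)
    (hy : Epi G (fun v => (yy G d v)^2) ≤ Q) : ∀ j ≤ t, ∀ f : V → ℝ,
    Epi G f = 0 → Epi G (fun v => |f v|) ≤ M → Epi G (fun v => (f v)^2) ≤ Q →
    |E (fun φ => f (φ j))| ≤ ∑ i ∈ range j,
      (1 / (16 * t) * Sl G par E (i + 1) + 1100 * t ^ 3 * 2 ^ t * Q / d) := by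
  intro j
  induction j using Nat.strong_induction_on with
  | _ j ih =>
  intro hj f hf0 hfM hfQ
  rcases Nat.eq_zero_or_pos j with rfl | hj1
  · simp [c.zero, hf0]
  have hp := c.par_lt j hj1 hj
  have hd := c.dpos
  have hQ : 0 ≤ Q := (Epi_nonneg G fun v => sq_nonneg (f v)).trans hfQ
  rw [c.step' hj1 hj]
  have h1 := ih _ hp (by omega) (P G f) (by rw [Epi_P G c.Dpos, hf0])
    ((c.Epi_abs_P f).trans hfM) ((c.Epi_sq_P f).trans hfQ)
  have h2 := c.fine_R hMQ hy hj1 hj hf0 hfM hfQ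
  refine (abs_add_le _ _).trans ((add_le_add h1 h2).trans ?_)
  obtain ⟨k, rfl⟩ : ∃ k, j = k + 1 := ⟨j - 1, by omega⟩
  rw [sum_range_succ]
  apply add_le_add _ le_rfl
  apply sum_le_sum_of_subset_of_nonneg
  · intro a; simp; omega
  · intro i hi _
    have hi' : i < k := mem_range.1 hi
    have : 0 ≤ Sl G par E (i + 1) := c.E_nonneg fun φ h =>
      div_nonneg (by positivity) (c.X_pos h (by omega) (by omega)).le
    positivity

end Ctx
end
end TreeCount

namespace TreeCount

open Finset

lemma log_bound {x : ℝ} (hx : 1 / 16 ≤ x) :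
    (1 - 1 / x) + (1 - 1 / x) ^ 2 / 25 ≤ Real.log x := by
  have hx0 : 0 < x := by linarith
  set r := Real.sqrt (1 / x) with hr
  have hr2 : r ^ 2 = 1 / x := Real.sq_sqrt (by positivity)
  have hrpos : 0 < r := Real.sqrt_pos.2 (by positivity)
  have hr4 : r ≤ 4 := by
    have : r ^ 2 ≤ 16 := by
      rw [hr2, div_le_iff₀ hx0]; linarith
    nlinarith
  have hl : Real.log x = - (2 * Real.log r) := by
    have : Real.log (r ^ 2) = 2 * Real.log r := by rw [Real.log_pow]; norm_num
    rw [← this, hr2, one_div, Real.log_inv]; ring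
  have h1 := Real.log_le_sub_one_of_pos hrpos
  rw [← hr2, hl]
  have h3 : 0 ≤ (r - 1) ^ 2 * (25 - (1 + r) ^ 2) := by
    apply mul_nonneg (sq_nonneg _); nlinarith
  nlinarith

lemma final_arith {t : ℕ} {d Q S S2 S' T k : ℝ} (ht1 : (1 : ℝ) ≤ t) (hd1 : 1000000 ≤ d)
    (hbig : 1000000 * (t : ℝ) ^ 5 * 2 ^ t ≤ d) (hS2 : 0 ≤ S2) (hS3 : 0 ≤ S') (hkt : k + 1 ≤ t)
    (hQ0 : 0 ≤ Q) (hSs : S = S' + S2)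
    (hT2 : T = 1 / (16 * t) * S + t * (1100 * t ^ 3 * 2 ^ t * Q / d)) :
    0 ≤ 1 / 2 * S' - k * (2 * T + 138 * t ^ 2 * 2 ^ t * Q / d) +
      (1 / 2 * S2 - (2 * T + 138 * t ^ 2 * 2 ^ t * Q / d)
      + ((1 / 2 - 512 / d ^ 2) * Q - 32 / d * S2) / 25) := by
  have hd : 0 < d := by linarith
  have hS0 : 0 ≤ S := by rw [hSs]; positivity
  have hW0 : 0 ≤ 2 * T + 138 * t ^ 2 * 2 ^ t * Q / d := by rw [hT2]; positivity
  have w1 : (k + 1) * (2 * T + 138 * t ^ 2 * 2 ^ t * Q / d)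
      ≤ t * (2 * T + 138 * t ^ 2 * 2 ^ t * Q / d) := mul_le_mul_of_nonneg_right hkt hW0
  have w2 : t * (2 * T + 138 * t ^ 2 * 2 ^ t * Q / d)
      = 1 / 8 * S + (2200 * t ^ 5 * 2 ^ t + 138 * t ^ 3 * 2 ^ t) * Q / d := by
    rw [hT2]; field_simp; ring
  have w3 : (2200 * t ^ 5 * 2 ^ t + 138 * t ^ 3 * 2 ^ t) * Q / d ≤ 1 / 100 * Q := by
    rw [div_le_iff₀ hd]
    have a3 : (t : ℝ) ^ 3 ≤ t ^ 5 := pow_le_pow_right₀ ht1 (by norm_num)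
    have a4 : (2200 * t ^ 5 * 2 ^ t + 138 * t ^ 3 * 2 ^ t) ≤ 1 / 100 * d := by
      have := mul_le_mul_of_nonneg_right a3 (by positivity : (0:ℝ) ≤ 2 ^ t)
      have : (0 : ℝ) ≤ t ^ 5 * 2 ^ t := by positivity
      linarith
    have := mul_le_mul_of_nonneg_right a4 hQ0
    linarith
  have w4 : 512 / d ^ 2 ≤ 1 / 100 := by
    rw [div_le_iff₀ (by positivity)]; nlinarith
  have w5 : 32 / d ≤ 1 / 100 := by
    rw [div_le_iff₀ hd]; linarith
  have w6 := mul_le_mul_of_nonneg_right w4 hQ0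
  have w7 := mul_le_mul_of_nonneg_right w5 hS2
  linarith

section
variable {V : Type} [Fintype V] [DecidableEq V] {G : SimpleGraph V} [DecidableRel G.Adj]
variable {par : ℕ → ℕ} {t : ℕ} {d : ℝ} {E : ((ℕ → V) → ℝ) →ₗ[ℝ] ℝ}

lemma Epi_yy (hD : ∀ v, 0 < D G v) (hs : ∑ v, D G v = Fintype.card V * d) :
    Epi G (yy G d) = 0 := by
  unfold Epi
  have : ∀ v, D G v * yy G d v = D G v - d := fun v => by
    have := (hD v).ne'
    unfold yy; field_simp
  simp_rw [this]
  rw [sum_sub_distrib, hs]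
  simp

lemma M_le (hD : ∀ v, 0 < D G v) (hs : ∑ v, D G v = Fintype.card V * d) (hd : 1 ≤ d) :
    Epi G (fun v => |yy G d v|) ≤ 8 * d * Epi G (fun v => (yy G d v) ^ 2) := by
  unfold Epi
  rw [← mul_div_assoc]
  apply div_le_div_of_nonneg_right _ (sum_nonneg fun v _ => (hD v).le)
  have h0 : ∀ v, D G v * yy G d v = D G v - d := fun v => by
    have := (hD v).ne'
    unfold yy; field_simp
  have h1 : ∀ v, D G v * |yy G d v| = |D G v - d| := fun v => by
    rw [← h0, abs_mul, abs_of_pos (hD v)]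
  have h2 : ∀ v, D G v * (yy G d v) ^ 2 = (D G v - d) ^ 2 / D G v := fun v => by
    have := (hD v).ne'
    rw [← h0]; field_simp
  simp_rw [h1, h2]
  have hz : ∑ v, (D G v - d) = 0 := by rw [sum_sub_distrib, hs]; simp
  set m := round d with hm
  have hm2 := abs_sub_round d
  rw [← hm, abs_le] at hm2
  have key : ∀ v, D G v = ((G.degree v : ℤ) : ℝ) := fun v => by simp [D]
  rw [mul_sum]
  by_cases hc : (m : ℝ) ≤ d
  · have e : ∑ v, |D G v - d| = ∑ v, (|D G v - d| + (D G v - d)) := by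
      rw [sum_add_distrib, hz, add_zero]
    rw [e]
    apply sum_le_sum
    intro v _
    have hDv := hD v
    rcases le_or_gt (D G v) d with h | h
    · rw [abs_of_nonpos (by linarith)]
      have : 0 ≤ 8 * d * ((D G v - d) ^ 2 / D G v) := by positivity
      linarith
    · rw [abs_of_pos (by linarith), ← mul_div_assoc, le_div_iff₀ hDv]
      have : m + 1 ≤ (G.degree v : ℤ) := by
        have : (m : ℝ) < ((G.degree v : ℤ) : ℝ) := by rw [← key]; linarith
        have : m < (G.degree v : ℤ) := by exact_mod_cast this
        omega
      have : (m : ℝ) + 1 ≤ D G v := by rw [key]; exact_mod_cast this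
      have h4 : 1 / 2 ≤ D G v - d := by linarith
      set ε := D G v - d
      have h5 : D G v ≤ 4 * d * ε := by
        have : D G v = d + ε := by simp [ε]
        nlinarith
      nlinarith
  · have e : ∑ v, |D G v - d| = ∑ v, (|D G v - d| - (D G v - d)) := by
      rw [sum_sub_distrib, hz, sub_zero]
    rw [e]
    apply sum_le_sum
    intro v _
    have hDv := hD v
    rcases le_or_gt d (D G v) with h | h
    · rw [abs_of_nonneg (by linarith)]
      have : 0 ≤ 8 * d * ((D G v - d) ^ 2 / D G v) := by positivity
      linarith
    · rw [abs_of_neg (by linarith), ← mul_div_assoc, le_div_iff₀ hDv]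
      push Not at hc
      have : (G.degree v : ℤ) + 1 ≤ m := by
        have : ((G.degree v : ℤ) : ℝ) < m := by rw [← key]; linarith
        have : (G.degree v : ℤ) < m := by exact_mod_cast this
        omega
      have : D G v + 1 ≤ (m : ℝ) := by rw [key]; exact_mod_cast this
      have h4 : 1 / 2 ≤ d - D G v := by linarith
      have e2 : (D G v - d) ^ 2 = (d - D G v) ^ 2 := by ring
      rw [e2]
      have e3 : -(D G v - d) - (D G v - d) = 2 * (d - D G v) := by ring
      rw [e3]
      set ε := d - D G v
      have h5 : D G v ≤ 4 * d * ε := by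
        nlinarith
      nlinarith

namespace Ctx

lemma Sl_nonneg (c : Ctx G par t d E)
    {j : ℕ} (hj1 : 1 ≤ j) (hj : j ≤ t) : 0 ≤ Sl G par E j :=
  c.E_nonneg fun φ h => div_nonneg (by positivity) (c.X_pos h hj1 hj).le

lemma Sl_one (c : Ctx G par t d E) : Sl G par E 1 = 0 := by
  unfold Sl
  have : ∀ φ : ℕ → V, ((C G par 1 φ).card : ℝ) / X G par 1 φ = 0 := by
    intro φ
    have := card_UC G par φ (c.par_lt 1 le_rfl c.t_pos)
    have h2 : (0 : ℝ) ≤ (U G par 1 φ).card := by positivity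
    have h3 : (0 : ℝ) ≤ (C G par 1 φ).card := by positivity
    have : ((C G par 1 φ).card : ℝ) = 0 := by push_cast at this; linarith
    rw [this, zero_div]
  simp_rw [this]
  exact map_zero E

section pointwise

lemma z_eq (c : Ctx G par t d E)
    {φ : ℕ → V} (h : Set.InjOn φ (range (t + 1) : Finset ℕ)) {j : ℕ} (hj1 : 1 ≤ j) (hj : j ≤ t)
    : 1 - 1 / (X G par j φ / (d - (j - 1))) = yy G d (φ (par j)) +
    ((U G par j φ).card * yy G d (φ (par j)) + (C G par j φ).card) / X G par j φ := by
  have hX := c.X_pos h hj1 hj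
  have hXe := X_eq G par (c.inj' h hj)
  have hUC := card_UC G par φ (c.par_lt j hj1 hj)
  have hD := c.Dpos (φ (par j))
  have hy : D G (φ (par j)) * yy G d (φ (par j)) = D G (φ (par j)) - d := by
    unfold yy; field_simp
  set x := X G par j φ
  set y := yy G d (φ (par j))
  set u : ℝ := ((U G par j φ).card : ℝ)
  set s : ℝ := ((C G par j φ).card : ℝ)
  rw [one_div_div, eq_comm, ← sub_eq_zero]
  have : y + (u * y + s) / x - (1 - (d - (j - 1)) / x) = (x * y + u * y + s - x + d - (j - 1)) / x := by
    field_simp; ring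
  rw [this, div_eq_zero_iff]
  left
  rw [hXe]
  linarith

lemma z_ge (c : Ctx G par t d E)
    {φ : ℕ → V} (h : Set.InjOn φ (range (t + 1) : Finset ℕ)) {j : ℕ} (hj1 : 1 ≤ j) (hj : j ≤ t)
    : (1 + (j - 1) / d) * yy G d (φ (par j)) + 1 / 2 * ((C G par j φ).card / X G par j φ)
      - 10 * t / d * (yy G d (φ (par j))) ^ 2 - 16 * t ^ 2 / d ^ 2 * |yy G d (φ (par j))|
    ≤ 1 - 1 / (X G par j φ / (d - (j - 1))) := by
  rw [c.z_eq h hj1 hj]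
  have hX := c.X_pos h hj1 hj
  have hd := c.dpos
  have hUC := card_UC G par φ (c.par_lt j hj1 hj)
  have hC := c.C_le h hj1 hj
  have hi := c.inv_X_le h hj1 hj
  have hdiff := c.inv_diff h hj1 hj
  have hjt : (j : ℝ) - 1 ≤ t := by
    have : (j : ℝ) ≤ t := by exact_mod_cast hj
    linarith
  have hj0 : 0 ≤ (j : ℝ) - 1 := by
    have : (1 : ℝ) ≤ j := by exact_mod_cast hj1
    linarith
  set x := X G par j φ
  set y := yy G d (φ (par j))
  set s : ℝ := ((C G par j φ).card : ℝ)
  have hs : 0 ≤ s := by positivity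
  have hu : ((U G par j φ).card : ℝ) = j - 1 - s := by linarith
  rw [hu]
  have e : y + ((j - 1 - s) * y + s) / x = (1 + (j - 1) / d) * y
      + (j - 1) * ((1 / x - 1 / d) * y) - (s / x) * y + s / x := by
    field_simp; ring
  rw [e]
  have a1 : -(2 * y ^ 2 / d + 16 * t / d ^ 2 * |y|) ≤ (1 / x - 1 / d) * y := by
    have : |(1 / x - 1 / d) * y| ≤ 2 * y ^ 2 / d + 16 * t / d ^ 2 * |y| := by
      rw [abs_mul]
      calc _ ≤ (2 * |y| / d + 16 * t / d ^ 2) * |y| :=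
            mul_le_mul_of_nonneg_right hdiff (abs_nonneg _)
        _ = 2 * (|y| ^ 2) / d + 16 * t / d ^ 2 * |y| := by ring
        _ = _ := by rw [sq_abs]
    exact neg_le_of_abs_le this
  have a2 : -(t * (2 * y ^ 2 / d + 16 * t / d ^ 2 * |y|)) ≤ (j - 1) * ((1 / x - 1 / d) * y) := by
    have p : 0 ≤ 2 * y ^ 2 / d + 16 * t / d ^ 2 * |y| := by positivity
    nlinarith [mul_le_mul_of_nonneg_left a1 hj0, mul_le_mul_of_nonneg_right hjt p]
  have a3 : (s / x) * y ≤ 1 / 2 * (s / x) + 8 * t / d * y ^ 2 := by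
    have b1 : 0 ≤ s / x := by positivity
    have b2 : s / x ≤ 16 * t / d := by
      calc s / x = s * (1 / x) := by ring
        _ ≤ t * (16 / d) := by gcongr
        _ = _ := by ring
    have b3 : y ≤ 1 / 2 + y ^ 2 / 2 := by nlinarith [sq_nonneg (y - 1)]
    calc (s / x) * y ≤ (s / x) * (1 / 2 + y ^ 2 / 2) := by gcongr
      _ = 1 / 2 * (s / x) + (s / x) * (y ^ 2 / 2) := by ring
      _ ≤ 1 / 2 * (s / x) + (16 * t / d) * (y ^ 2 / 2) := by gcongr
      _ = _ := by ring
  have e2 : 10 * t / d * y ^ 2 + 16 * t ^ 2 / d ^ 2 * |y|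
     = t * (2 * y ^ 2 / d + 16 * t / d ^ 2 * |y|) + 8 * t / d * y ^ 2 := by ring
  linarith

end pointwise

lemma z2_sq (c : Ctx G par t d E)
    {φ : ℕ → V} (h : Set.InjOn φ (range (t + 1) : Finset ℕ)) (ht : 2 ≤ t) :
    (1 / 2 - 512 / d ^ 2) * (yy G d (φ (par 2))) ^ 2
      - 32 / d * ((C G par 2 φ).card / X G par 2 φ)
    ≤ (1 - 1 / (X G par 2 φ / (d - ((2 : ℕ) - 1)))) ^ 2 := by
  rw [c.z_eq h (by norm_num) ht]
  have hX := c.X_pos h (by norm_num) ht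
  have hd := c.dpos
  have hUC := card_UC G par φ (c.par_lt 2 (by norm_num) ht)
  have hi := c.inv_X_le h (by norm_num) ht
  set x := X G par 2 φ
  set y := yy G d (φ (par 2))
  set s : ℝ := ((C G par 2 φ).card : ℝ)
  set u : ℝ := ((U G par 2 φ).card : ℝ)
  have hs : 0 ≤ s := by positivity
  have hu : 0 ≤ u := by positivity
  have hus : u + s = 1 := by rw [hUC]; norm_num
  have b : ((u * y + s) / x) ^ 2 ≤ 512 / d ^ 2 * y ^ 2 + 32 / d * (s / x) := by
    have b0 : (u * y + s) ^ 2 ≤ 2 * y ^ 2 + 2 * s := by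
      have hu1 : u ^ 2 ≤ 1 := by nlinarith
      have hs1 : s ^ 2 ≤ s := by nlinarith
      nlinarith [sq_nonneg (u * y - s), mul_le_mul_of_nonneg_right hu1 (sq_nonneg y)]
    calc ((u * y + s) / x) ^ 2 = (u * y + s) ^ 2 * (1 / x) ^ 2 := by ring
      _ ≤ (2 * y ^ 2 + 2 * s) * (1 / x) ^ 2 := by gcongr
      _ = 2 * y ^ 2 * (1 / x) ^ 2 + 2 * (s / x) * (1 / x) := by ring
      _ ≤ 2 * y ^ 2 * (16 / d) ^ 2 + 2 * (s / x) * (16 / d) := by gcongr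
      _ = _ := by ring
  nlinarith [sq_nonneg (y + 2 * ((u * y + s) / x))]

lemma E_y2 (c : Ctx G par t d E)
    (ht : 2 ≤ t) (g : V → ℝ) : E (fun φ => g (φ (par 2))) = Epi G g := by
  have hp := c.par_lt 2 (by norm_num) ht
  have hp1 := c.par_lt 1 (by norm_num) (by omega)
  obtain h0 | h1 : par 2 = 0 ∨ par 2 = 1 := by omega
  · rw [h0, c.zero]
  · rw [h1, c.step' (by norm_num) (by omega)]
    have : ∀ φ : ℕ → V, U G par 1 φ = ∅ := by
      intro φ
      have e : par 1 = 0 := by omega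
      unfold U
      rw [e]; rfl
    simp_rw [this]
    have e : par 1 = 0 := by omega
    rw [e, c.zero, Epi_P G c.Dpos]
    simp only [sum_empty, zero_div]
    have : E (fun _ => 0) = 0 := map_zero E
    rw [this, add_zero]

lemma E_z_ge (c : Ctx G par t d E)
    {M Q : ℝ} (hMQ : M ≤ 8 * d * Q)
    (hy : Epi G (fun v => (yy G d v)^2) ≤ Q) (hy0 : Epi G (yy G d) = 0)
    (hyM : Epi G (fun v => |yy G d v|) ≤ M) {j : ℕ} (hj1 : 1 ≤ j) (hj : j ≤ t) :
    1 / 2 * Sl G par E j - 2 * ∑ i ∈ range t,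
      (1 / (16 * t) * Sl G par E (i + 1) + 1100 * t ^ 3 * 2 ^ t * Q / d)
      - 138 * t ^ 2 * 2 ^ t * Q / d
    ≤ E (fun φ => 1 - 1 / (X G par j φ / (d - (j - 1)))) := by
  have hp := c.par_lt j hj1 hj
  have hd := c.dpos
  have ht1 := c.t1
  have hQ : 0 ≤ Q := (Epi_nonneg G fun v => sq_nonneg (yy G d v)).trans hy
  have hA : (0 : ℝ) ≤ 2 ^ t := by positivity
  have h1 := c.mono _ _ fun φ h => c.z_ge h hj1 hj
  refine le_trans ?_ h1
  simp only [E_add, E_sub, E_smul]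
  have h2 := c.fine hMQ hy (par j) (by omega) (yy G d) hy0 hyM hy
  have h3 : ∑ i ∈ range (par j),
      (1 / (16 * t) * Sl G par E (i + 1) + 1100 * t ^ 3 * 2 ^ t * Q / d) ≤ ∑ i ∈ range t,
      (1 / (16 * t) * Sl G par E (i + 1) + 1100 * t ^ 3 * 2 ^ t * Q / d) := by
    apply sum_le_sum_of_subset_of_nonneg
    · intro a; simp; omega
    · intro i hi _
      have := c.Sl_nonneg (j := i + 1) (by omega) (by have := mem_range.1 hi; omega)
      positivity
  have h2' := h2.trans h3
  set T := ∑ i ∈ range t,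
      (1 / (16 * t) * Sl G par E (i + 1) + 1100 * t ^ 3 * 2 ^ t * Q / d)
  have l1 := (c.dom (j := par j) (by omega) (g := fun v => (yy G d v)^2)
    (fun v => sq_nonneg _)).trans (mul_le_mul_of_nonneg_left hy hA)
  have l2 := (c.dom (j := par j) (by omega) (g := fun v => |yy G d v|)
    (fun v => abs_nonneg _)).trans (mul_le_mul_of_nonneg_left (hyM.trans hMQ) hA)
  have hj0 : 0 ≤ (j : ℝ) - 1 := by
    have : (1 : ℝ) ≤ j := by exact_mod_cast hj1
    linarith
  have hjt : ((j : ℝ) - 1) / d ≤ 1 := by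
    rw [div_le_one hd]
    have : (j : ℝ) ≤ t := by exact_mod_cast hj
    linarith [c.dbig]
  have hj2 : 0 ≤ ((j : ℝ) - 1) / d := by positivity
  have k1 : -(2 * T) ≤ (1 + (j - 1) / d) * E (fun φ => yy G d (φ (par j))) := by
    have := neg_le_of_abs_le h2'
    have hT : 0 ≤ T := (abs_nonneg _).trans h2'
    nlinarith
  have k2 : 10 * t / d * E (fun φ => (yy G d (φ (par j))) ^ 2) ≤ 10 * t / d * (2 ^ t * Q) := by
    gcongr
  have k3 : 16 * t ^ 2 / d ^ 2 * E (fun φ => |yy G d (φ (par j))|)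
      ≤ 16 * t ^ 2 / d ^ 2 * (2 ^ t * (8 * d * Q)) := by gcongr
  have k4 : 10 * t / d * (2 ^ t * Q) + 16 * t ^ 2 / d ^ 2 * (2 ^ t * (8 * d * Q))
      ≤ 138 * t ^ 2 * 2 ^ t * Q / d := by
    have : 10 * t / d * (2 ^ t * Q) ≤ 10 * t ^ 2 / d * (2 ^ t * Q) := by
      gcongr
      nlinarith
    refine (add_le_add_left this _).trans (le_of_eq ?_)
    field_simp; ring
  change _ ≤ (1 + (j - 1) / d) * E (fun φ => yy G d (φ (par j))) + 1 / 2 * Sl G par E j - _ - _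
  linarith

theorem log_sum (c : Ctx G par t d E) {k : ℕ} (hk : t = k + 2) (hs : ∑ v, D G v = Fintype.card V * d)
    (hbig : 1000000 * (t : ℝ) ^ 5 * 2 ^ t ≤ d) :
    0 ≤ E (fun φ => ∑ i ∈ range (k + 1), Real.log (X G par (i + 2) φ / (d - (i + 1)))) := by
  have hd := c.dpos
  have ht1 := c.t1
  have hA : (1 : ℝ) ≤ 2 ^ t := one_le_pow₀ (by norm_num)
  have h51 : (1 : ℝ) ≤ t ^ 5 := one_le_pow₀ ht1
  have hd1 : 1000000 ≤ d := by nlinarith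
  set Q := Epi G (fun v => (yy G d v) ^ 2) with hQ
  set M := Epi G (fun v => |yy G d v|) with hM
  have hMQ : M ≤ 8 * d * Q := M_le c.Dpos hs (by linarith)
  have hQ0 : 0 ≤ Q := Epi_nonneg G fun v => sq_nonneg _
  have hy0 := Epi_yy c.Dpos hs
  have hlog : ∀ i ∈ range (k + 1), ∀ φ : ℕ → V, Set.InjOn φ (range (t + 1) : Finset ℕ) →
      (1 - 1 / (X G par (i + 2) φ / (d - ((i + 2 : ℕ) - 1)))) +
      (1 - 1 / (X G par (i + 2) φ / (d - ((i + 2 : ℕ) - 1)))) ^ 2 / 25 ≤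
      Real.log (X G par (i + 2) φ / (d - (i + 1))) := by
    intro i hi φ h
    have hi := mem_range.1 hi
    have e : ((i + 2 : ℕ) : ℝ) - 1 = i + 1 := by push_cast; ring
    rw [e]
    apply log_bound
    have hx := c.X_ge h (j := i + 2) (by omega) (by omega)
    have hit : (i : ℝ) + 1 ≤ t := by exact_mod_cast (by omega : i + 1 ≤ t)
    have := c.dbig
    rw [le_div_iff₀ (by linarith)]
    have : (0 : ℝ) ≤ i := by positivity
    linarith
  rw [E_sum, sum_range_succ']
  set T := ∑ i ∈ range t,
      (1 / (16 * t) * Sl G par E (i + 1) + 1100 * t ^ 3 * 2 ^ t * Q / d) with hT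
  have g1 : ∀ i ∈ range k, 1 / 2 * Sl G par E (i + 1 + 2) - (2 * T + 138 * t ^ 2 * 2 ^ t * Q / d) ≤
      E (fun φ => Real.log (X G par (i + 1 + 2) φ / (d - ((i + 1 : ℕ) + 1)))) := by
    intro i hi
    have hi := mem_range.1 hi
    have := c.E_z_ge hMQ hQ.ge hy0 hM.ge (j := i + 1 + 2) (by omega) (by omega)
    rw [← sub_sub]
    refine this.trans (c.mono _ _ fun φ h => ?_)
    have := hlog (i + 1) (mem_range.2 (by omega)) φ h
    refine le_trans ?_ this
    have : 0 ≤ (1 - 1 / (X G par (i + 1 + 2) φ / (d - ((i + 1 + 2 : ℕ) - 1)))) ^ 2 / 25 := by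
      positivity
    linarith
  have g2 : 1 / 2 * Sl G par E 2 - (2 * T + 138 * t ^ 2 * 2 ^ t * Q / d)
      + ((1 / 2 - 512 / d ^ 2) * Q - 32 / d * Sl G par E 2) / 25 ≤
      E (fun φ => Real.log (X G par (0 + 2) φ / (d - ((0 : ℕ) + 1)))) := by
    have q1 := c.E_z_ge hMQ hQ.ge hy0 hM.ge (j := 2) (by omega) (by omega)
    have q2 := c.mono _ _ fun φ h => hlog 0 (mem_range.2 (by omega)) φ h
    refine le_trans ?_ q2
    have q3 := c.mono _ _ fun φ h => c.z2_sq h (by omega)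
    rw [E_sub, E_smul, E_smul, c.E_y2 (by omega) (fun v => (yy G d v) ^ 2)] at q3
    have e : (fun φ : ℕ → V => (1 - 1 / (X G par (0 + 2) φ / (d - ((0 + 2 : ℕ) - 1)))) +
      (1 - 1 / (X G par (0 + 2) φ / (d - ((0 + 2 : ℕ) - 1)))) ^ 2 / 25) =
      (fun φ : ℕ → V => (1 - 1 / (X G par 2 φ / (d - ((2 : ℕ) - 1)))) +
      (1 / 25) * (1 - 1 / (X G par 2 φ / (d - ((2 : ℕ) - 1)))) ^ 2) := by
      ext φ; simp only [zero_add]; ring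
    rw [e, E_add, E_smul]
    change _ - 32 / d * Sl G par E 2 ≤ _ at q3
    linarith
  have g3 := add_le_add (sum_le_sum g1) g2
  refine le_trans ?_ g3
  rw [sum_sub_distrib, ← mul_sum, sum_const, card_range, nsmul_eq_mul]
  set S := ∑ i ∈ range t, Sl G par E (i + 1) with hS
  have hSs : S = ∑ i ∈ range k, Sl G par E (i + 1 + 2) + Sl G par E 2 := by
    rw [hS, hk, sum_range_succ', sum_range_succ', zero_add, c.Sl_one, add_zero]
  have hT2 : T = 1 / (16 * t) * S + t * (1100 * t ^ 3 * 2 ^ t * Q / d) := by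
    rw [hT, sum_add_distrib, ← mul_sum, sum_const, card_range, nsmul_eq_mul]
  have hS2 : 0 ≤ Sl G par E 2 := c.Sl_nonneg (by norm_num) (by omega)
  have hS3 : 0 ≤ ∑ i ∈ range k, Sl G par E (i + 1 + 2) := sum_nonneg fun i hi =>
    c.Sl_nonneg (by omega) (by have := mem_range.1 hi; omega)
  have hkt : (k : ℝ) + 1 ≤ t := by exact_mod_cast (by omega : k + 1 ≤ t)
  exact final_arith (k := (k : ℝ)) ht1 hd1 hbig hS2 hS3 hkt hQ0 hSs hT2

end Ctx
end
end TreeCount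

namespace TreeCount

open Finset

section
variable {V : Type} [Fintype V] [DecidableEq V] (G : SimpleGraph V) [DecidableRel G.Adj]
variable (par : ℕ → ℕ)

/-- One averaging step. -/
noncomputable def stepMap (j : ℕ) : ((ℕ → V) → ℝ) →ₗ[ℝ] ((ℕ → V) → ℝ) where
  toFun F := fun φ => (∑ w ∈ ext G par j φ, F (Function.update φ j w)) / X G par j φ
  map_add' F H := by
    ext φ; simp only [Pi.add_apply, sum_add_distrib, add_div]
  map_smul' a F := by
    ext φ; simp only [Pi.smul_apply, smul_eq_mul, RingHom.id_apply, ← mul_sum, mul_div_assoc]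

/-- Initial expectation. -/
noncomputable def startMap : ((ℕ → V) → ℝ) →ₗ[ℝ] ℝ where
  toFun F := Epi G (fun v => F (fun _ => v))
  map_add' F H := by
    simp only [Epi, Pi.add_apply, mul_add, sum_add_distrib, add_div]
  map_smul' a F := by
    simp only [Epi, Pi.smul_apply, smul_eq_mul, RingHom.id_apply, mul_left_comm _ a, ← mul_sum,
      mul_div_assoc]

/-- Expectation over the random embedding process. -/
noncomputable def Eop : ℕ → (((ℕ → V) → ℝ) →ₗ[ℝ] ℝ)
  | 0 => startMap G
  | j + 1 => (Eop j).comp (stepMap G par (j + 1))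

/-- Sum over all embeddings. -/
noncomputable def Sop : ℕ → ((ℕ → V) → ℝ) → ℝ
  | 0, F => ∑ v, F (fun _ => v)
  | j + 1, F => Sop j (fun φ => ∑ w ∈ ext G par (j + 1) φ, F (Function.update φ (j + 1) w))

lemma Eop_succ (j : ℕ) (F : (ℕ → V) → ℝ) : Eop G par (j + 1) F = Eop G par j
    (fun φ => (∑ w ∈ ext G par (j + 1) φ, F (Function.update φ (j + 1) w)) / X G par (j + 1) φ) :=
  rfl

lemma Eop_zero (F : (ℕ → V) → ℝ) : Eop G par 0 F = Epi G (fun v => F (fun _ => v)) := rfl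

lemma inj_update {j : ℕ} {φ : ℕ → V} (h : Set.InjOn φ (range (j + 1) : Finset ℕ)) {w : V}
    (hw : w ∈ ext G par (j + 1) φ) :
    Set.InjOn (Function.update φ (j + 1) w) (range (j + 1 + 1) : Finset ℕ) := by
  have hw2 : ∀ a < j + 1, φ a ≠ w := by
    intro a ha e
    simp only [ext, mem_sdiff, mem_image, mem_range, not_exists, not_and] at hw
    exact hw.2 a ha e
  intro a ha b hb hab
  simp only [coe_range, Set.mem_Iio] at ha hb
  by_cases ea : a = j + 1 <;> by_cases eb : b = j + 1
  · omega
  · subst ea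
    rw [Function.update_self, Function.update_of_ne eb] at hab
    exact absurd hab.symm (hw2 b (by omega))
  · subst eb
    rw [Function.update_self, Function.update_of_ne ea] at hab
    exact absurd hab (hw2 a (by omega))
  · rw [Function.update_of_ne ea, Function.update_of_ne eb] at hab
    exact h (by simp; omega) (by simp; omega) hab

lemma Eop_mono : ∀ (j : ℕ) (F H : (ℕ → V) → ℝ),
    (∀ φ, Set.InjOn φ (range (j + 1) : Finset ℕ) → F φ ≤ H φ) → Eop G par j F ≤ Eop G par j H
  | 0, F, H, h => by
    rw [Eop_zero, Eop_zero]
    apply Epi_mono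
    intro v
    apply h
    intro a ha b hb _
    simp at ha hb; omega
  | j + 1, F, H, h => by
    rw [Eop_succ, Eop_succ]
    apply Eop_mono j
    intro φ hφ
    apply div_le_div_of_nonneg_right _ (by unfold X; positivity)
    exact sum_le_sum fun w hw => h _ (inj_update G par hφ hw)

lemma Eop_congr (j : ℕ) {F H : (ℕ → V) → ℝ}
    (h : ∀ φ, Set.InjOn φ (range (j + 1) : Finset ℕ) → F φ = H φ) :
    Eop G par j F = Eop G par j H :=
  le_antisymm (Eop_mono G par j _ _ fun φ hφ => (h φ hφ).le)
    (Eop_mono G par j _ _ fun φ hφ => (h φ hφ).ge)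

variable {par} in
lemma ext_update (hpar : ∀ j, 1 ≤ j → par j < j) {j k : ℕ} (hj : 1 ≤ j) (hjk : j ≤ k) (φ : ℕ → V)
    (w : V) : ext G par j (Function.update φ k w) = ext G par j φ := by
  have := hpar j hj
  unfold ext
  rw [Function.update_of_ne (by omega)]
  congr 1
  apply image_congr
  intro a ha
  simp at ha
  exact Function.update_of_ne (by omega) _ _

variable {par} in
lemma X_update (hpar : ∀ j, 1 ≤ j → par j < j) {j k : ℕ} (hj : 1 ≤ j) (hjk : j ≤ k) (φ : ℕ → V)
    (w : V) : X G par j (Function.update φ k w) = X G par j φ := by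
  unfold X; rw [ext_update G hpar hj hjk]

lemma Eop_const {t : ℕ} (hX : ∀ j, 1 ≤ j → j ≤ t → ∀ φ : ℕ → V,
      Set.InjOn φ (range j : Finset ℕ) → 0 < X G par j φ)
    {j : ℕ} (F : (ℕ → V) → ℝ)
    (hF : ∀ k, j < k → ∀ φ w, F (Function.update φ k w) = F φ) :
    ∀ k, j ≤ k → k ≤ t → Eop G par k F = Eop G par j F := by
  intro k hjk
  induction k, hjk using Nat.le_induction with
  | base => intro _; rfl
  | succ k hk ih =>
    intro hkt
    rw [← ih (by omega), Eop_succ]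
    apply Eop_congr
    intro φ hφ
    have hx := hX (k + 1) (by omega) hkt φ hφ
    have : ∀ w, F (Function.update φ (k + 1) w) = F φ := hF (k + 1) (by omega) φ
    simp_rw [this]
    rw [sum_const, nsmul_eq_mul]
    change X G par (k + 1) φ * _ / _ = _
    field_simp

lemma mkCtx [Nonempty V] {t : ℕ} {d : ℝ} (ht : 1 ≤ t) (hpar : ∀ j, 1 ≤ j → par j < j)
    (hdeg : ∀ v, d / 8 ≤ D G v) (hbig : 16 * (t : ℝ) ≤ d) : Ctx G par t d (Eop G par t) := by
  have ht1 : (1 : ℝ) ≤ t := by exact_mod_cast ht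
  have hD : ∀ v, 0 < D G v := fun v => by linarith [hdeg v]
  have hX : ∀ j, 1 ≤ j → j ≤ t → ∀ φ : ℕ → V,
      Set.InjOn φ (range j : Finset ℕ) → 0 < X G par j φ := by
    intro j hj1 hj φ h
    rw [X_eq G par h]
    have := card_UC G par φ (hpar j hj1)
    have h2 : (0 : ℝ) ≤ (C G par j φ).card := by positivity
    have h3 : (j : ℝ) ≤ t := by exact_mod_cast hj
    linarith [hdeg (φ (par j))]
  refine ⟨ht, fun j h _ => hpar j h, Eop_mono G par t, ?_, ?_, ?_, hdeg, hbig⟩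
  · rw [Eop_const G par hX (j := 0) (fun _ => 1) (fun _ _ _ _ => rfl) t (by omega) le_rfl, Eop_zero]
    simp only [Epi, mul_one]
    exact div_self (sum_pos (fun v _ => hD v) univ_nonempty).ne'
  · intro f
    rw [Eop_const G par hX (j := 0) (fun φ => f (φ 0)) _ t (by omega) le_rfl, Eop_zero]
    intro k hk φ w
    rw [Function.update_of_ne (by omega)]
  · intro j hj1 hj f
    obtain ⟨i, rfl⟩ : ∃ i, j = i + 1 := ⟨j - 1, by omega⟩
    rw [Eop_const G par hX (j := i + 1) (fun φ => f (φ (i + 1))) _ t (by omega) le_rfl,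
      Eop_const G par hX (j := i) _ _ t (by omega) le_rfl, Eop_succ]
    · simp only [Function.update_self]
    · intro k hk φ w
      rw [ext_update G hpar (by omega) (by omega), X_update G hpar (by omega) (by omega)]
    · intro k hk φ w
      rw [Function.update_of_ne (by omega)]

/-- inverse probability weight -/
noncomputable def W (j : ℕ) (φ : ℕ → V) : ℝ :=
  (∑ v, D G v) / D G (φ 0) * ∏ i ∈ range j, X G par (i + 1) φ

lemma Sop_eq [Nonempty V] (hpar : ∀ j, 1 ≤ j → par j < j) (hD : ∀ v, 0 < D G v) :
    ∀ (j : ℕ) (F : (ℕ → V) → ℝ), Sop G par j F = Eop G par j (fun φ => F φ * W G par j φ)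
  | 0, F => by
    have hs : 0 < ∑ v, D G v := sum_pos (fun v _ => hD v) univ_nonempty
    rw [Eop_zero, Sop, Epi, eq_div_iff hs.ne', sum_mul]
    apply sum_congr rfl
    intro v _
    have := (hD v).ne'
    simp only [W, range_zero, prod_empty]
    field_simp
  | j + 1, F => by
    rw [Sop, Sop_eq hpar hD j, Eop_succ]
    congr 1
    ext φ
    have hW : ∀ w, W G par (j + 1) (Function.update φ (j + 1) w)
        = W G par j φ * X G par (j + 1) φ := by
      intro w
      unfold W
      rw [prod_range_succ, X_update G hpar (by omega) le_rfl, Function.update_of_ne (by omega),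
        mul_assoc]
      congr 2
      apply prod_congr rfl
      intro i hi
      have := mem_range.1 hi
      rw [X_update G hpar (by omega) (by omega)]
    simp_rw [hW]
    rw [← sum_mul]
    by_cases hx : X G par (j + 1) φ = 0
    · have : ext G par (j + 1) φ = ∅ := by
        unfold X at hx
        exact card_eq_zero.1 (by exact_mod_cast hx)
      rw [this]; simp
    · field_simp

lemma Sop_set : ∀ j : ℕ, ∃ A : Finset (ℕ → V), (∀ F, Sop G par j F = ∑ φ ∈ A, F φ) ∧
    (∀ φ ∈ A, Set.InjOn φ (range (j + 1) : Finset ℕ) ∧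
      (∀ i, 1 ≤ i → i ≤ j → par i < i → G.Adj (φ (par i)) (φ i)) ∧ ∀ i, j < i → φ i = φ 0)
  | 0 => by
    classical
    refine ⟨univ.image (fun v _ => v), ?_, ?_⟩
    · intro F
      rw [sum_image]
      · rfl
      · intro a _ b _ h
        exact congrFun h 0
    · intro φ hφ
      obtain ⟨v, _, rfl⟩ := mem_image.1 hφ
      refine ⟨?_, ?_, ?_⟩
      · intro a ha b hb _
        simp at ha hb; omega
      · intro i h1 h2; omega
      · intro i _; rfl
  | j + 1 => by
    classical
    obtain ⟨A, hA, hA2⟩ := Sop_set j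
    refine ⟨(A.sigma (fun φ => ext G par (j + 1) φ)).image
      (fun p => Function.update p.1 (j + 1) p.2), ?_, ?_⟩
    · intro F
      rw [sum_image, sum_sigma, Sop, hA]
      rintro ⟨φ, w⟩ h1 ⟨ψ, w'⟩ h2 h
      simp only [coe_sigma, Set.mem_sigma_iff, mem_coe] at h1 h2
      simp only at h
      have e1 : w = w' := by simpa using congrFun h (j + 1)
      have e0 : φ 0 = ψ 0 := by simpa using congrFun h 0
      have e2 : φ = ψ := by
        ext i
        by_cases hi : i = j + 1
        · rw [(hA2 φ h1.1).2.2 i (by omega), (hA2 ψ h2.1).2.2 i (by omega), e0]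
        · have := congrFun h i
          rwa [Function.update_of_ne hi, Function.update_of_ne hi] at this
      subst e1; subst e2; rfl
    · intro ψ hψ
      obtain ⟨⟨φ, w⟩, hp, rfl⟩ := mem_image.1 hψ
      rw [mem_sigma] at hp
      obtain ⟨hφ, hw⟩ := hp
      simp only at hφ hw ⊢
      obtain ⟨a1, a2, a3⟩ := hA2 φ hφ
      refine ⟨inj_update G par a1 hw, ?_, ?_⟩
      · intro i h1 h2 h3
        by_cases hi : i = j + 1
        · subst hi
          rw [Function.update_self, Function.update_of_ne (by omega)]
          simp only [ext, mem_sdiff, SimpleGraph.mem_neighborFinset] at hw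
          exact hw.1
        · rw [Function.update_of_ne hi, Function.update_of_ne (by omega)]
          exact a2 i h1 (by omega) h3
      · intro i hi
        rw [Function.update_of_ne (by omega), Function.update_of_ne (by omega)]
        exact a3 i (by omega)

/-- `idx` enumerates the vertices of `T`, with parents given by `par`. -/
def IsEnum {α : Type} (T : SimpleGraph α) (t : ℕ) (par : ℕ → ℕ) (idx : α → ℕ) : Prop :=
  (∀ j, 1 ≤ j → par j < j) ∧ Function.Injective idx ∧ (∀ i, i ≤ t ↔ i ∈ Set.range idx) ∧
  ∀ a b, T.Adj a b → (1 ≤ idx b ∧ idx a = par (idx b)) ∨ (1 ≤ idx a ∧ idx b = par (idx a))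

lemma Sop_le {α : Type} [Finite α] {T : SimpleGraph α} {t : ℕ} {idx : α → ℕ}
    (h : IsEnum T t par idx) : Sop G par t (fun _ => 1) ≤ monCount T G := by
  classical
  obtain ⟨A, hA, hA2⟩ := Sop_set G par t
  obtain ⟨hpar, hi, hr, hT⟩ := h
  rw [hA, sum_const, nsmul_eq_mul, mul_one]
  have hle : ∀ a, idx a ≤ t := fun a => (hr _).2 ⟨a, rfl⟩
  let Φ : A → {f : α → V // Function.Injective f ∧ ∀ ⦃u v : α⦄, T.Adj u v → G.Adj (f u) (f v)} :=
    fun φ => ⟨fun a => φ.1 (idx a), by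
      intro a b hab
      apply hi
      apply (hA2 φ.1 φ.2).1 _ _ hab
      · have := hle a; simp; omega
      · have := hle b; simp; omega, by
      intro u v huv
      rcases hT u v huv with ⟨h1, h2⟩ | ⟨h1, h2⟩
      · show G.Adj (φ.1 (idx u)) (φ.1 (idx v))
        rw [h2]
        exact (hA2 φ.1 φ.2).2.1 _ h1 (hle v) (hpar _ h1)
      · show G.Adj (φ.1 (idx u)) (φ.1 (idx v))
        rw [h2]
        exact ((hA2 φ.1 φ.2).2.1 _ h1 (hle u) (hpar _ h1)).symm⟩
  have hΦ : Function.Injective Φ := by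
    rintro ⟨φ, hφ⟩ ⟨ψ, hψ⟩ h
    have h' : ∀ a, φ (idx a) = ψ (idx a) := fun a => congrFun (congrArg Subtype.val h) a
    have hle' : ∀ i ≤ t, φ i = ψ i := by
      intro i hit
      obtain ⟨a, rfl⟩ := (hr i).1 hit
      exact h' a
    apply Subtype.ext
    ext i
    by_cases hit : i ≤ t
    · exact hle' i hit
    · simp only
      rw [(hA2 φ hφ).2.2 i (by omega), (hA2 ψ hψ).2.2 i (by omega), hle' 0 (by omega)]
  have := Nat.card_le_card_of_injective Φ hΦ
  unfold monCount
  rw [Nat.card_eq_fintype_card, Fintype.card_coe] at this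
  exact_mod_cast this

lemma good_case [Nonempty V] {α : Type} [Finite α] {T : SimpleGraph α} {t k : ℕ} {idx : α → ℕ}
    (h : IsEnum T t par idx) (hk : t = k + 2) {d : ℝ} (hs : ∑ v, D G v = Fintype.card V * d)
    (hbig : 1000000 * (t : ℝ) ^ 5 * 2 ^ t ≤ d) (hdeg : ∀ v, d / 8 ≤ D G v) :
    (Fintype.card V : ℝ) * fallFact d t ≤ monCount T G := by
  have hpar := h.1
  have ht1 : (1 : ℝ) ≤ t := by exact_mod_cast (by omega : 1 ≤ t)
  have hA : (1 : ℝ) ≤ 2 ^ t := one_le_pow₀ (by norm_num)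
  have h51 : (t : ℝ) ≤ t ^ 5 := by simpa using pow_le_pow_right₀ ht1 (show 1 ≤ 5 by norm_num)
  have hbig2 : 16 * (t : ℝ) ≤ d := by nlinarith
  have c := mkCtx G par (by omega) hpar hdeg hbig2
  refine le_trans ?_ (Sop_le G par h)
  rw [Sop_eq G par hpar c.Dpos]
  have hd := c.dpos
  have hlt : ∀ i ∈ range (k + 1), 0 < d - ((i : ℝ) + 1) := by
    intro i hi
    have hi := mem_range.1 hi
    have hit : (i : ℝ) + 1 ≤ t := by exact_mod_cast (by omega : i + 1 ≤ t)
    linarith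
  set Pr : ℝ := ∏ i ∈ range (k + 1), (d - ((i : ℝ) + 1)) with hPr
  have hPr0 : 0 < Pr := prod_pos hlt
  have hff : fallFact d t = Pr * d := by
    unfold fallFact
    rw [hk, prod_range_succ']
    push_cast
    simp [hPr]
  have key : ∀ φ : ℕ → V, Set.InjOn φ (range (t + 1) : Finset ℕ) →
      Fintype.card V * d * Pr * (1 + ∑ i ∈ range (k + 1),
        Real.log (X G par (i + 2) φ / (d - (i + 1)))) ≤ 1 * W G par t φ := by
    intro φ hφ
    have hX1 : X G par 1 φ = D G (φ 0) := by
      rw [X_eq G par (c.inj' hφ (by omega))]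
      have e : par 1 = 0 := by have := hpar 1 le_rfl; omega
      have : U G par 1 φ = ∅ := by
        unfold U
        rw [e]; rfl
      rw [this, e]; simp
    have hW : W G par t φ = Fintype.card V * d * ∏ i ∈ range (k + 1), X G par (i + 2) φ := by
      unfold W
      have hD := (c.Dpos (φ 0)).ne'
      rw [hs, hk, prod_range_succ', zero_add, hX1]
      simp only [add_assoc, Nat.reduceAdd]
      field_simp
    rw [one_mul, hW, mul_assoc]
    apply mul_le_mul_of_nonneg_left _ (by positivity)
    have hXp : ∀ i ∈ range (k + 1), 0 < X G par (i + 2) φ / (d - (i + 1)) := by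
      intro i hi
      have hi' := mem_range.1 hi
      exact div_pos (c.X_pos hφ (by omega) (by omega)) (hlt i hi)
    have e1 : ∏ i ∈ range (k + 1), X G par (i + 2) φ
        = Pr * ∏ i ∈ range (k + 1), (X G par (i + 2) φ / (d - (i + 1))) := by
      rw [hPr, ← prod_mul_distrib]
      apply prod_congr rfl
      intro i hi
      have := (hlt i hi).ne'
      field_simp
    rw [e1]
    apply mul_le_mul_of_nonneg_left _ hPr0.le
    have e2 : ∏ i ∈ range (k + 1), (X G par (i + 2) φ / (d - (i + 1)))
        = Real.exp (∑ i ∈ range (k + 1), Real.log (X G par (i + 2) φ / (d - (i + 1)))) := by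
      rw [Real.exp_sum]
      exact prod_congr rfl fun i hi => (Real.exp_log (hXp i hi)).symm
    rw [e2, add_comm]
    exact Real.add_one_le_exp _
  refine le_trans ?_ (c.mono _ _ key)
  rw [E_smul, E_add, c.one, hff]
  have := c.log_sum hk hs hbig
  have h2 : 0 ≤ (Fintype.card V : ℝ) * d * Pr := by positivity
  nlinarith [mul_nonneg h2 this]

end
end TreeCount

namespace TreeCount

open Finset

lemma exists_enum : ∀ (t : ℕ) (α : Type) [Fintype α] (T : SimpleGraph α), T.IsTree →
    Fintype.card α = t + 1 → ∃ par idx, IsEnum T t par idx := by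
  intro t
  induction t with
  | zero =>
    intro α _ T hT hc
    have hs : Subsingleton α := Fintype.card_le_one_iff_subsingleton.1 (by omega)
    have hn : Nonempty α := Fintype.card_pos_iff.1 (by omega)
    refine ⟨fun j => j - 1, fun _ => 0, fun j hj => ?_, fun a b _ => Subsingleton.elim a b,
      fun i => ?_, fun a b hab => ?_⟩
    · simp only; omega
    · simp
    · exact absurd (Subsingleton.elim a b) hab.ne
  | succ t ih =>
    intro α _ T hT hc
    classical
    have : Nontrivial α := Fintype.one_lt_card_iff_nontrivial.1 (by omega)
    obtain ⟨v, hv⟩ := hT.exists_vert_degree_one_of_nontrivial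
    obtain ⟨u, huv, hu⟩ := SimpleGraph.degree_eq_one_iff_existsUnique_adj.1 hv
    have hT' : (T.induce {v}ᶜ).IsTree :=
      ⟨hT.1.induce_compl_singleton_of_degree_eq_one hv, hT.2.induce _⟩
    have hc' : Fintype.card ({v}ᶜ : Set α) = t + 1 := by
      rw [Fintype.card_compl_set, hc]; simp
    obtain ⟨par, idx, h1, h2, h3, h4⟩ := ih _ _ hT' hc'
    have hle : ∀ a, idx a ≤ t := fun a => (h3 _).2 ⟨a, rfl⟩
    have huv' : u ∈ ({v}ᶜ : Set α) := by
      have := huv.ne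
      simp only [Set.mem_compl_iff, Set.mem_singleton_iff]
      exact fun e => this e.symm
    let idx' : α → ℕ := fun a => if h : a ∈ ({v}ᶜ : Set α) then idx ⟨a, h⟩ else t + 1
    have e1 : ∀ a (h : a ∈ ({v}ᶜ : Set α)), idx' a = idx ⟨a, h⟩ := fun a h => dif_pos h
    have e2 : idx' v = t + 1 := dif_neg (by simp)
    have hm : ∀ a, a ≠ v → a ∈ ({v}ᶜ : Set α) := fun a h => by simpa using h
    refine ⟨Function.update par (t + 1) (idx ⟨u, huv'⟩), idx', ?_, ?_, ?_, ?_⟩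
    · intro j hj
      by_cases hjt : j = t + 1
      · subst hjt
        rw [Function.update_self]
        have := hle ⟨u, huv'⟩
        omega
      · rw [Function.update_of_ne hjt]; exact h1 j hj
    · intro a b hab
      by_cases ha : a = v <;> by_cases hb : b = v
      · rw [ha, hb]
      · rw [ha, e2, e1 b (hm b hb)] at hab
        have := hle ⟨b, hm b hb⟩; omega
      · rw [hb, e2, e1 a (hm a ha)] at hab
        have := hle ⟨a, hm a ha⟩; omega
      · rw [e1 b (hm b hb), e1 a (hm a ha)] at hab
        exact congrArg Subtype.val (h2 hab)
    · intro i
      constructor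
      · intro hi
        by_cases hit : i = t + 1
        · exact ⟨v, by rw [e2, hit]⟩
        · obtain ⟨a, ha⟩ := (h3 i).1 (by omega)
          exact ⟨a.1, by rw [e1 a.1 a.2, ← ha]⟩
      · rintro ⟨a, rfl⟩
        by_cases ha : a = v
        · rw [ha, e2]
        · rw [e1 a (hm a ha)]
          have := hle ⟨a, hm a ha⟩; omega
    · intro a b hab
      by_cases ha : a = v
      · subst ha
        right
        have hb : b = u := hu b hab
        subst hb
        rw [e2, Function.update_self, e1 _ huv']
        exact ⟨by omega, rfl⟩
      by_cases hb : b = v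
      · subst hb
        left
        have ha : a = u := hu a hab.symm
        subst ha
        rw [e2, Function.update_self, e1 _ huv']
        exact ⟨by omega, rfl⟩
      rw [e1 b (hm b hb), e1 a (hm a ha)]
      have q1 := hle ⟨a, hm a ha⟩
      have q2 := hle ⟨b, hm b hb⟩
      rw [Function.update_of_ne (by omega), Function.update_of_ne (by omega)]
      exact h4 ⟨a, hm a ha⟩ ⟨b, hm b hb⟩ hab

lemma sum_D {β : Type} [Fintype β] [DecidableEq β] [Nonempty β] (G : SimpleGraph β)
    [DecidableRel G.Adj] : ∑ v, D G v = Fintype.card β * avgDeg G := by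
  have h := G.sum_degrees_eq_twice_card_edges
  have h0 : (Fintype.card β : ℝ) ≠ 0 := by exact_mod_cast Fintype.card_ne_zero
  unfold D avgDeg
  rw [← Nat.cast_sum, h, Nat.card_eq_fintype_card, SimpleGraph.edgeFinset_card]
  push_cast
  field_simp

lemma case_one {β : Type} [Fintype β] [DecidableEq β] [Nonempty β] (G : SimpleGraph β)
    [DecidableRel G.Adj] {α : Type} [Finite α] {T : SimpleGraph α} {par : ℕ → ℕ} {idx : α → ℕ}
    (h : IsEnum T 1 par idx) :
    (Fintype.card β : ℝ) * fallFact (avgDeg G) 1 ≤ monCount T G := by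
  refine le_trans ?_ (Sop_le G par h)
  have e0 : fallFact (avgDeg G) 1 = avgDeg G := by simp [fallFact]
  rw [e0, ← sum_D]
  show _ ≤ ∑ v, _
  apply sum_le_sum
  intro v _
  have e : par 1 = 0 := by have := h.1 1 le_rfl; omega
  have hx : X G par 1 (fun _ => v) = D G v := by
    rw [X_eq G par (by simp)]
    have : U G par 1 (fun _ => v) = ∅ := by
      unfold U
      rw [e]; rfl
    rw [this]; simp
  rw [← hx]
  simp [X]

lemma fallFact_step {k : ℕ} {m d e : ℝ} (hm : 0 < m) (hd : ((k : ℝ) + 2) ≤ d)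
    (he : 3 * d / 4 ≤ m * e) :
    (m + 1) * fallFact d (k + 2) ≤ m * fallFact (d + e) (k + 2) := by
  have hk : (0 : ℝ) ≤ k := Nat.cast_nonneg k
  have he0 : 0 ≤ e := by
    by_contra hn
    push Not at hn
    nlinarith
  have e1 : ∀ x : ℝ, fallFact x (k + 2)
      = x * (x - 1) * ∏ i ∈ range k, (x - ((i : ℝ) + 2)) := by
    intro x
    unfold fallFact
    rw [prod_range_succ', prod_range_succ']
    push_cast
    simp only [add_assoc]
    norm_num
    ring
  rw [e1, e1, ← mul_assoc (m + 1), ← mul_assoc m]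
  have hp : ∀ i ∈ range k, 0 ≤ d - ((i : ℝ) + 2) := by
    intro i hi
    have : (i : ℝ) ≤ k := by exact_mod_cast (mem_range.1 hi).le
    linarith
  apply mul_le_mul
  · have q1 : 3 * d / 4 * (2 * d - 1) ≤ m * e * (2 * d - 1) :=
      mul_le_mul_of_nonneg_right he (by linarith)
    have q2 := mul_nonneg hm.le (sq_nonneg e)
    have q3 : 0 ≤ d * d := mul_self_nonneg d
    nlinarith
  · apply prod_le_prod hp
    intro i _
    linarith
  · exact prod_nonneg hp
  · have : 0 ≤ (d + e) * (d + e - 1) := mul_nonneg (by linarith) (by linarith)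
    positivity

lemma monCount_induce {α β : Type} [Finite α] [Finite β] (T : SimpleGraph α) (G : SimpleGraph β)
    (s : Set β) : monCount T (G.induce s) ≤ monCount T G := by
  unfold monCount
  apply Nat.card_le_card_of_injective
    (fun f => ⟨fun a => (f.1 a).1, fun a b hab => f.2.1 (Subtype.ext hab),
      fun u v huv => f.2.2 huv⟩)
  intro f g hfg
  apply Subtype.ext
  funext a
  exact Subtype.ext (congrFun (congrArg Subtype.val hfg) a)

lemma main_ge_two (k : ℕ) {α : Type} [Finite α] {T : SimpleGraph α} {par : ℕ → ℕ} {idx : α → ℕ}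
    (h : IsEnum T (k + 2) par idx) : ∀ (n : ℕ) (β : Type) [Fintype β] (G : SimpleGraph β),
    Fintype.card β = n → 1000000 * ((k + 2 : ℕ) : ℝ) ^ 5 * 2 ^ (k + 2) ≤ avgDeg G →
    (Fintype.card β : ℝ) * fallFact (avgDeg G) (k + 2) ≤ monCount T G := by
  intro n
  induction n with
  | zero =>
    intro β _ G hn _
    rw [hn]; simp
  | succ n ih =>
    intro β _ G hn hd
    classical
    have hne : Nonempty β := Fintype.card_pos_iff.1 (by omega)
    have hs := sum_D G
    by_cases hdeg : ∀ v, avgDeg G / 8 ≤ D G v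
    · exact good_case G par h rfl hs hd hdeg
    push Not at hdeg
    obtain ⟨v, hv⟩ := hdeg
    have hk1 : (1 : ℝ) ≤ ((k + 2 : ℕ) : ℝ) := by exact_mod_cast (by omega : 1 ≤ k + 2)
    have hA : (1 : ℝ) ≤ 2 ^ (k + 2) := one_le_pow₀ (by norm_num)
    have h51 : ((k + 2 : ℕ) : ℝ) ≤ ((k + 2 : ℕ) : ℝ) ^ 5 := by
      simpa using pow_le_pow_right₀ hk1 (show 1 ≤ 5 by norm_num)
    have hdk : ((k + 2 : ℕ) : ℝ) ≤ avgDeg G := by nlinarith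
    have hd0 : 0 < avgDeg G := by linarith
    have hcard : Fintype.card ({v}ᶜ : Set β) = n := by
      rw [Fintype.card_compl_set, hn]; simp
    have hn0 : 0 < n := by
      by_contra h0
      have h0 : n = 0 := by omega
      have hsub : Subsingleton β := Fintype.card_le_one_iff_subsingleton.1 (by omega)
      have : ∑ w, D G w = D G v := Fintype.sum_subsingleton _ v
      rw [this, hn, h0] at hs
      norm_num at hs
      linarith
    have hnR : (0 : ℝ) < n := by exact_mod_cast hn0
    have hE : Nat.card (G.induce {v}ᶜ).edgeSet + G.degree v = Nat.card G.edgeSet := by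
      have a1 := G.card_edgeFinset_induce_compl_singleton v
      rw [G.card_edgeFinset_deleteIncidenceSet] at a1
      have a2 : G.degree v ≤ #G.edgeFinset := by
        rw [← G.card_incidenceFinset_eq_degree]
        exact card_le_card (G.incidenceFinset_subset v)
      rw [Nat.card_eq_fintype_card, Nat.card_eq_fintype_card, ← SimpleGraph.edgeFinset_card,
        ← SimpleGraph.edgeFinset_card]
      omega
    have hE' : (Nat.card (G.induce {v}ᶜ).edgeSet : ℝ) + D G v = Nat.card G.edgeSet := by
      unfold D; exact_mod_cast hE
    have a3 : (n + 1 : ℝ) * avgDeg G = 2 * Nat.card G.edgeSet := by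
      unfold avgDeg
      rw [hn]
      push_cast
      field_simp
    have a4 : (n : ℝ) * avgDeg (G.induce {v}ᶜ) = 2 * Nat.card (G.induce {v}ᶜ).edgeSet := by
      unfold avgDeg
      rw [hcard]
      field_simp
    have a5 : 3 * avgDeg G / 4 ≤ n * (avgDeg (G.induce {v}ᶜ) - avgDeg G) := by
      linarith
    have a6 : 0 ≤ avgDeg (G.induce {v}ᶜ) - avgDeg G := by
      by_contra hneg
      push Not at hneg
      nlinarith
    have b1 := ih _ (G.induce {v}ᶜ) hcard (by linarith)
    have b2 := fallFact_step (k := k) hnR (by push_cast at hdk; exact hdk) a5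
    rw [add_sub_cancel] at b2
    have b3 : (monCount T (G.induce {v}ᶜ) : ℝ) ≤ monCount T G := by
      exact_mod_cast monCount_induce T G _
    rw [hcard] at b1
    rw [hn]
    push_cast
    linarith

end TreeCount

/-- Theorem 1.1 (lower bound): every `n`-vertex graph with large enough average degree `d`
contains at least `n·d(d-1)⋯(d-t+1)` labeled copies of any tree on `t+1` vertices. -/
theorem tree_count_lower_bound (t : ℕ) (ht : 0 < t) :
    ∃ d0 : ℝ, ∀ (α β : Type) [Fintype α] [Fintype β]
      (T : SimpleGraph α) (G : SimpleGraph β),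
      T.IsTree → Fintype.card α = t + 1 →
      d0 ≤ avgDeg G →
      (Fintype.card β : ℝ) * fallFact (avgDeg G) t ≤ (monCount T G : ℝ) := by
  refine ⟨1000000 * (t : ℝ) ^ 5 * 2 ^ t, ?_⟩
  intro α β _ _ T G hT hc hd
  classical
  obtain ⟨par, idx, h⟩ := TreeCount.exists_enum t α T hT hc
  rcases isEmpty_or_nonempty β with hβ | hβ
  · simp
  by_cases h1 : t = 1
  · subst h1
    exact TreeCount.case_one G h
  · obtain ⟨k, rfl⟩ : ∃ k, t = k + 2 := ⟨t - 2, by omega⟩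
    exact TreeCount.main_ge_two k h _ β G rfl hd
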